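/- Let k > 2 and s > 2 both be even, and for c ∈ {0,1} set Z̄_c = Z(A^{k,s}_c)/T₁(A^{k,s}_c)^⊥ and J̄_c = rad(Z̄_c). Then in Z̄_1 the relation (βγα)^{k−1}βγ = η^{s/2} + (αβγ)^{k/2} + (βγα)^{k/2} + (γαβ)^{k/2} holds, dim_F J̄_1/J̄_1² = 2 (spanned by the cosets of η and αβγ + βγα + γαβ), while dim_F J̄_0/J̄_0² = 3 (spanned by the cosets of η, αβγ + βγα + γαβ, and (βγα)^{k−1}βγ). In particular Z̄_0 and Z̄_1 are not isomorphic as F-algebras. -/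

import Mathlib

/- Common setup: the algebras D(2B)^{k,s}(c) of dihedral type, over a field F,
   presented as a quotient of the free algebra on the paths-generators
   e₁, e₂ (trivial paths), α (loop at vertex 1), β (arrow 1 → 2),
   γ (arrow 2 → 1), η (loop at vertex 2), by the path-algebra relations
   together with Erdmann's relations
   βη = 0, ηγ = 0, γβ = 0, α² = c(αβγ)^k, (αβγ)^k = (βγα)^k, η^s = (γαβ)^k. -/

noncomputable section

namespace DihedralPaper

inductive Gen : Type
  | e1 | e2 | a | b | g | h

variable (F : Type) [Field F]

/-- The generators inside the free algebra. -/
def gen (t : Gen) : FreeAlgebra F Gen := FreeAlgebra.ι F t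

/-- The defining relations of `D(2B)^{k,s}(c)` (paths written from left to right). -/
inductive Rel (k s : ℕ) (c : F) : FreeAlgebra F Gen → FreeAlgebra F Gen → Prop
  | unit : Rel k s c (gen F .e1 + gen F .e2) 1
  | idem1 : Rel k s c (gen F .e1 * gen F .e1) (gen F .e1)
  | idem2 : Rel k s c (gen F .e2 * gen F .e2) (gen F .e2)
  | orth12 : Rel k s c (gen F .e1 * gen F .e2) 0
  | orth21 : Rel k s c (gen F .e2 * gen F .e1) 0
  | aL : Rel k s c (gen F .e1 * gen F .a) (gen F .a)
  | aR : Rel k s c (gen F .a * gen F .e1) (gen F .a)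
  | bL : Rel k s c (gen F .e1 * gen F .b) (gen F .b)
  | bR : Rel k s c (gen F .b * gen F .e2) (gen F .b)
  | gL : Rel k s c (gen F .e2 * gen F .g) (gen F .g)
  | gR : Rel k s c (gen F .g * gen F .e1) (gen F .g)
  | hL : Rel k s c (gen F .e2 * gen F .h) (gen F .h)
  | hR : Rel k s c (gen F .h * gen F .e2) (gen F .h)
  | bh : Rel k s c (gen F .b * gen F .h) 0
  | hg : Rel k s c (gen F .h * gen F .g) 0
  | gb : Rel k s c (gen F .g * gen F .b) 0
  | asq : Rel k s c (gen F .a * gen F .a) (c • (gen F .a * gen F .b * gen F .g) ^ k)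
  | abg : Rel k s c ((gen F .a * gen F .b * gen F .g) ^ k) ((gen F .b * gen F .g * gen F .a) ^ k)
  | hs : Rel k s c ((gen F .h) ^ s) ((gen F .g * gen F .a * gen F .b) ^ k)

/-- The algebra `A^{k,s}_c = D(2B)^{k,s}(c)`. -/
def DA (k s : ℕ) (c : F) : Type := RingQuot (Rel F k s c)

instance (k s : ℕ) (c : F) : Ring (DA F k s c) :=
  inferInstanceAs (Ring (RingQuot (Rel F k s c)))

instance (k s : ℕ) (c : F) : Algebra F (DA F k s c) :=
  inferInstanceAs (Algebra F (RingQuot (Rel F k s c)))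

variable (k s : ℕ) (c : F)

/-- The canonical projection. -/
def mk : FreeAlgebra F Gen →ₐ[F] DA F k s c := RingQuot.mkAlgHom F (Rel F k s c)

def E1 : DA F k s c := mk F k s c (gen F .e1)
def E2 : DA F k s c := mk F k s c (gen F .e2)
/-- The image of the loop α at vertex 1. -/
def Al : DA F k s c := mk F k s c (gen F .a)
/-- The image of the arrow β : 1 → 2. -/
def Be : DA F k s c := mk F k s c (gen F .b)
/-- The image of the arrow γ : 2 → 1. -/
def Ga : DA F k s c := mk F k s c (gen F .g)
/-- The image of the loop η at vertex 2. -/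
def Et : DA F k s c := mk F k s c (gen F .h)

/-- The path αβγ. -/
def ABG : DA F k s c := Al F k s c * Be F k s c * Ga F k s c
/-- The path βγα. -/
def BGA : DA F k s c := Be F k s c * Ga F k s c * Al F k s c
/-- The path γαβ. -/
def GAB : DA F k s c := Ga F k s c * Al F k s c * Be F k s c

/-- The standard basis paths 𝓑₁₁ of e₁Ae₁. -/
def B11 : Set (DA F k s c) :=
  {E1 F k s c, Al F k s c, Be F k s c * Ga F k s c, (ABG F k s c) ^ k}
    ∪ (fun i => (ABG F k s c) ^ i) '' Set.Icc 1 (k - 1)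
    ∪ (fun i => (ABG F k s c) ^ i * Al F k s c) '' Set.Icc 1 (k - 1)
    ∪ (fun i => (BGA F k s c) ^ i) '' Set.Icc 1 (k - 1)
    ∪ (fun i => (BGA F k s c) ^ i * (Be F k s c * Ga F k s c)) '' Set.Icc 1 (k - 1)

/-- The standard basis paths 𝓑₁₂ of e₁Ae₂. -/
def B12 : Set (DA F k s c) :=
  {Be F k s c, Al F k s c * Be F k s c}
    ∪ (fun i => (BGA F k s c) ^ i * Be F k s c) '' Set.Icc 1 (k - 1)
    ∪ (fun i => (ABG F k s c) ^ i * (Al F k s c * Be F k s c)) '' Set.Icc 1 (k - 1)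

/-- The standard basis paths 𝓑₂₁ of e₂Ae₁. -/
def B21 : Set (DA F k s c) :=
  {Ga F k s c, Ga F k s c * Al F k s c}
    ∪ (fun i => (GAB F k s c) ^ i * Ga F k s c) '' Set.Icc 1 (k - 1)
    ∪ (fun i => (GAB F k s c) ^ i * (Ga F k s c * Al F k s c)) '' Set.Icc 1 (k - 1)

/-- The standard basis paths 𝓑₂₂ of e₂Ae₂. -/
def B22 : Set (DA F k s c) :=
  {E2 F k s c}
    ∪ (fun i => (GAB F k s c) ^ i) '' Set.Icc 1 (k - 1)
    ∪ (fun j => (Et F k s c) ^ j) '' Set.Icc 1 s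

/-- The standard path basis 𝓑 of `A^{k,s}_c`. -/
def BB : Set (DA F k s c) :=
  B11 F k s c ∪ B12 F k s c ∪ B21 F k s c ∪ B22 F k s c

/-- The commutator subspace K(A): the F-linear span of all commutators. -/
def Kspan (A : Type) [Ring A] [Algebra F A] : Submodule F A :=
  Submodule.span F {z : A | ∃ u v : A, z = u * v - v * u}

/-- The (left) socle of a ring: the sum of all simple (left) submodules. -/
def socle (A : Type) [Ring A] : Submodule A A := sSup {S : Submodule A A | IsAtom S}

/-- `ψ` is the linear form sending each standard basis path lying in the socle to 1
    and every other standard basis path to 0. -/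
def SoclePsi (ψ : DA F k s c →ₗ[F] F) : Prop :=
  ∀ p ∈ BB F k s c,
    (p ∈ socle (DA F k s c) → ψ p = 1) ∧ (p ∉ socle (DA F k s c) → ψ p = 0)

/-- `T₁(A) = {x : x² ∈ K(A)}`. -/
def T1set : Set (DA F k s c) := {z | z ^ 2 ∈ Kspan F (DA F k s c)}

/-- The orthogonal space `T₁(A)^⊥` with respect to the form `⟨x, y⟩ = ψ(xy)`. -/
def T1perp (ψ : DA F k s c →ₗ[F] F) : Set (DA F k s c) :=
  {y | ∀ x ∈ T1set F k s c, ψ (y * x) = 0}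

/-- The first generalized Reynolds ideal, as an ideal of the center `Z(A)`. -/
def ReynoldsIdeal (ψ : DA F k s c →ₗ[F] F) :
    Ideal (Subalgebra.center F (DA F k s c)) :=
  Ideal.span {z : Subalgebra.center F (DA F k s c) | (z : DA F k s c) ∈ T1perp F k s c ψ}


/-- The quotient `Z̄ = Z(A^{k,s}_c)/T₁(A^{k,s}_c)^⊥`. -/
def Zbar (ψ : DA F k s c →ₗ[F] F) : Type :=
  Subalgebra.center F (DA F k s c) ⧸ ReynoldsIdeal F k s c ψ

instance (ψ : DA F k s c →ₗ[F] F) : CommRing (Zbar F k s c ψ) :=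
  inferInstanceAs
    (CommRing (Subalgebra.center F (DA F k s c) ⧸ ReynoldsIdeal F k s c ψ))

instance (ψ : DA F k s c →ₗ[F] F) : Algebra F (Zbar F k s c ψ) :=
  inferInstanceAs
    (Algebra F (Subalgebra.center F (DA F k s c) ⧸ ReynoldsIdeal F k s c ψ))

/-- The projection `Z(A^{k,s}_c) → Z̄`. -/
def zq (ψ : DA F k s c →ₗ[F] F) :
    Subalgebra.center F (DA F k s c) →+* Zbar F k s c ψ :=
  Ideal.Quotient.mk (ReynoldsIdeal F k s c ψ)

/-- The Jacobson radical `J̄` of `Z̄`. -/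
def Jbar (ψ : DA F k s c →ₗ[F] F) : Ideal (Zbar F k s c ψ) :=
  Ideal.jacobson ⊥

/-- `dim_F J/J²` for an ideal `J` of a finite-dimensional F-algebra `R`. -/
def radQuotDim {R : Type} [CommRing R] [Algebra F R] (J : Ideal R) : ℕ :=
  Module.finrank F
    (↥(Submodule.restrictScalars F J) ⧸
      Submodule.comap (Submodule.restrictScalars F J).subtype
        (Submodule.restrictScalars F (J * J)))

section Paths

local notation "ε₁" => E1 F k s c
local notation "ε₂" => E2 F k s c
local notation "𝐚" => Al F k s c
local notation "𝐛" => Be F k s c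
local notation "𝐠" => Ga F k s c
local notation "𝐡" => Et F k s c
local notation "𝐮" => ABG F k s c
local notation "𝐯" => BGA F k s c
local notation "𝐰" => GAB F k s c

section Relations

lemma mk_rel {x y : FreeAlgebra F Gen} (h : Rel F k s c x y) :
    mk F k s c x = mk F k s c y :=
  RingQuot.mkAlgHom_rel F h

lemma E1_add_E2 : ε₁ + ε₂ = 1 := by simpa [E1, E2] using mk_rel F k s c .unit
lemma E1_mul_E1 : ε₁ * ε₁ = ε₁ := by simpa [E1] using mk_rel F k s c .idem1
lemma E2_mul_E2 : ε₂ * ε₂ = ε₂ := by simpa [E2] using mk_rel F k s c .idem2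
lemma E1_mul_E2 : ε₁ * ε₂ = 0 := by simpa [E1, E2] using mk_rel F k s c .orth12
lemma E2_mul_E1 : ε₂ * ε₁ = 0 := by simpa [E1, E2] using mk_rel F k s c .orth21
lemma E1_mul_Al : ε₁ * 𝐚 = 𝐚 := by simpa [E1, Al] using mk_rel F k s c .aL
lemma Al_mul_E1 : 𝐚 * ε₁ = 𝐚 := by simpa [E1, Al] using mk_rel F k s c .aR
lemma E1_mul_Be : ε₁ * 𝐛 = 𝐛 := by simpa [E1, Be] using mk_rel F k s c .bL
lemma Be_mul_E2 : 𝐛 * ε₂ = 𝐛 := by simpa [E2, Be] using mk_rel F k s c .bR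
lemma E2_mul_Ga : ε₂ * 𝐠 = 𝐠 := by simpa [E2, Ga] using mk_rel F k s c .gL
lemma Ga_mul_E1 : 𝐠 * ε₁ = 𝐠 := by simpa [E1, Ga] using mk_rel F k s c .gR
lemma E2_mul_Et : ε₂ * 𝐡 = 𝐡 := by simpa [E2, Et] using mk_rel F k s c .hL
lemma Et_mul_E2 : 𝐡 * ε₂ = 𝐡 := by simpa [E2, Et] using mk_rel F k s c .hR
lemma Be_mul_Et : 𝐛 * 𝐡 = 0 := by simpa [Be, Et] using mk_rel F k s c .bh
lemma Et_mul_Ga : 𝐡 * 𝐠 = 0 := by simpa [Ga, Et] using mk_rel F k s c .hg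
lemma Ga_mul_Be : 𝐠 * 𝐛 = 0 := by simpa [Ga, Be] using mk_rel F k s c .gb
lemma Al_mul_Al : 𝐚 * 𝐚 = c • 𝐮 ^ k := by
  simpa [Al, ABG, Be, Ga] using mk_rel F k s c .asq
lemma ABG_pow_eq_BGA_pow : 𝐮 ^ k = 𝐯 ^ k := by
  simpa [Al, ABG, BGA, Be, Ga] using mk_rel F k s c .abg
lemma Et_pow_eq_GAB_pow : 𝐡 ^ s = 𝐰 ^ k := by
  simpa [Al, GAB, Et, Be, Ga] using mk_rel F k s c .hs

lemma E1_mul_Ga : ε₁ * 𝐠 = 0 := by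
  rw [← E2_mul_Ga, ← mul_assoc, E1_mul_E2, zero_mul]
lemma E1_mul_Et : ε₁ * 𝐡 = 0 := by
  rw [← E2_mul_Et, ← mul_assoc, E1_mul_E2, zero_mul]
lemma E2_mul_Al : ε₂ * 𝐚 = 0 := by
  rw [← E1_mul_Al, ← mul_assoc, E2_mul_E1, zero_mul]
lemma Al_mul_E2 : 𝐚 * ε₂ = 0 := by
  rw [← Al_mul_E1, mul_assoc, E1_mul_E2, mul_zero]
lemma Ga_mul_E2 : 𝐠 * ε₂ = 0 := by
  rw [← Ga_mul_E1, mul_assoc, E1_mul_E2, mul_zero]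
lemma Be_mul_E1 : 𝐛 * ε₁ = 0 := by
  rw [← Be_mul_E2, mul_assoc, E2_mul_E1, mul_zero]
lemma Et_mul_E1 : 𝐡 * ε₁ = 0 := by
  rw [← Et_mul_E2, mul_assoc, E2_mul_E1, mul_zero]


end Relations

section Powers

variable {k s}

lemma Al_mul_BGA_pow (i : ℕ) : 𝐚 * 𝐯 ^ i = 𝐮 ^ i * 𝐚 :=
  SemiconjBy.pow_right (a := 𝐚) (x := 𝐯) (y := 𝐮) (by simp [SemiconjBy, ABG, BGA, mul_assoc]) i

lemma BeGa_mul_ABG_pow (i : ℕ) : 𝐛 * 𝐠 * 𝐮 ^ i = 𝐯 ^ i * (𝐛 * 𝐠) :=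
  SemiconjBy.pow_right (a := 𝐛 * 𝐠) (x := 𝐮) (y := 𝐯)
    (by simp [SemiconjBy, ABG, BGA, mul_assoc]) i

lemma Be_mul_GAB_pow (i : ℕ) : 𝐛 * 𝐰 ^ i = 𝐯 ^ i * 𝐛 :=
  SemiconjBy.pow_right (a := 𝐛) (x := 𝐰) (y := 𝐯) (by simp [SemiconjBy, GAB, BGA, mul_assoc]) i

lemma AlBe_mul_GAB_pow (i : ℕ) : 𝐚 * 𝐛 * 𝐰 ^ i = 𝐮 ^ i * (𝐚 * 𝐛) :=
  SemiconjBy.pow_right (a := 𝐚 * 𝐛) (x := 𝐰) (y := 𝐮)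
    (by simp [SemiconjBy, GAB, ABG, mul_assoc]) i

lemma Ga_mul_ABG_pow (i : ℕ) : 𝐠 * 𝐮 ^ i = 𝐰 ^ i * 𝐠 :=
  SemiconjBy.pow_right (a := 𝐠) (x := 𝐮) (y := 𝐰) (by simp [SemiconjBy, GAB, ABG, mul_assoc]) i

lemma E1_mul_ABG : ε₁ * 𝐮 = 𝐮 := by simp only [ABG, ← mul_assoc, E1_mul_Al]
lemma E1_mul_BGA : ε₁ * 𝐯 = 𝐯 := by simp only [BGA, ← mul_assoc, E1_mul_Be]
lemma E2_mul_GAB : ε₂ * 𝐰 = 𝐰 := by simp only [GAB, ← mul_assoc, E2_mul_Ga]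
lemma ABG_mul_E1 : 𝐮 * ε₁ = 𝐮 := by simp only [ABG, mul_assoc, Ga_mul_E1]
lemma BGA_mul_E1 : 𝐯 * ε₁ = 𝐯 := by simp only [BGA, mul_assoc, Al_mul_E1]
lemma GAB_mul_E2 : 𝐰 * ε₂ = 𝐰 := by simp only [GAB, mul_assoc, Be_mul_E2]

lemma E1_mul_ABG_pow {i : ℕ} (hi : i ≠ 0) : ε₁ * 𝐮 ^ i = 𝐮 ^ i := by
  obtain ⟨j, rfl⟩ := Nat.exists_eq_succ_of_ne_zero hi
  rw [Nat.succ_eq_add_one, pow_succ', ← mul_assoc, E1_mul_ABG]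
lemma E1_mul_BGA_pow {i : ℕ} (hi : i ≠ 0) : ε₁ * 𝐯 ^ i = 𝐯 ^ i := by
  obtain ⟨j, rfl⟩ := Nat.exists_eq_succ_of_ne_zero hi
  rw [Nat.succ_eq_add_one, pow_succ', ← mul_assoc, E1_mul_BGA]
lemma E2_mul_GAB_pow {i : ℕ} (hi : i ≠ 0) : ε₂ * 𝐰 ^ i = 𝐰 ^ i := by
  obtain ⟨j, rfl⟩ := Nat.exists_eq_succ_of_ne_zero hi
  rw [Nat.succ_eq_add_one, pow_succ', ← mul_assoc, E2_mul_GAB]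
lemma E2_mul_Et_pow {i : ℕ} (hi : i ≠ 0) : ε₂ * 𝐡 ^ i = 𝐡 ^ i := by
  obtain ⟨j, rfl⟩ := Nat.exists_eq_succ_of_ne_zero hi
  rw [Nat.succ_eq_add_one, pow_succ', ← mul_assoc, E2_mul_Et]
lemma E1_mul_ABG_pow_comm (i : ℕ) : ε₁ * 𝐮 ^ i = 𝐮 ^ i * ε₁ :=
  (Commute.pow_right ((E1_mul_ABG F c).trans (ABG_mul_E1 F c).symm) i)
lemma E1_mul_BGA_pow_comm (i : ℕ) : ε₁ * 𝐯 ^ i = 𝐯 ^ i * ε₁ :=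
  (Commute.pow_right ((E1_mul_BGA F c).trans (BGA_mul_E1 F c).symm) i)
lemma E2_mul_GAB_pow_comm (i : ℕ) : ε₂ * 𝐰 ^ i = 𝐰 ^ i * ε₂ :=
  (Commute.pow_right ((E2_mul_GAB F c).trans (GAB_mul_E2 F c).symm) i)
lemma E2_mul_Et_pow_comm (i : ℕ) : ε₂ * 𝐡 ^ i = 𝐡 ^ i * ε₂ :=
  (Commute.pow_right ((E2_mul_Et F k s c).trans (Et_mul_E2 F k s c).symm) i)

lemma Ga_mul_BGA : 𝐠 * 𝐯 = 0 := by simp only [BGA, ← mul_assoc, Ga_mul_Be, zero_mul]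
lemma Ga_mul_BGA_pow {i : ℕ} (hi : i ≠ 0) : 𝐠 * 𝐯 ^ i = 0 := by
  obtain ⟨j, rfl⟩ := Nat.exists_eq_succ_of_ne_zero hi
  rw [Nat.succ_eq_add_one, pow_succ', ← mul_assoc, Ga_mul_BGA, zero_mul]
lemma ABG_mul_Be : 𝐮 * 𝐛 = 0 := by simp only [ABG, mul_assoc, Ga_mul_Be, mul_zero]
lemma ABG_pow_mul_Be {i : ℕ} (hi : i ≠ 0) : 𝐮 ^ i * 𝐛 = 0 := by
  obtain ⟨j, rfl⟩ := Nat.exists_eq_succ_of_ne_zero hi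
  rw [Nat.succ_eq_add_one, pow_succ, mul_assoc, ABG_mul_Be, mul_zero]

lemma Ga_mul_ABG_pow_self (hs : 0 < s) : 𝐠 * 𝐮 ^ k = 0 := by
  obtain ⟨j, rfl⟩ := Nat.exists_eq_succ_of_ne_zero hs.ne'
  rw [Ga_mul_ABG_pow, ← Et_pow_eq_GAB_pow, Nat.succ_eq_add_one, pow_succ, mul_assoc, Et_mul_Ga,
    mul_zero]
lemma Al_mul_ABG (hk : 0 < k) : 𝐚 * 𝐮 = 0 := by
  rw [ABG, ← mul_assoc, ← mul_assoc, Al_mul_Al, smul_mul_assoc, ABG_pow_mul_Be F c hk.ne',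
    smul_zero, zero_mul]
lemma Al_mul_ABG_pow (hk : 0 < k) {i : ℕ} (hi : i ≠ 0) : 𝐚 * 𝐮 ^ i = 0 := by
  obtain ⟨j, rfl⟩ := Nat.exists_eq_succ_of_ne_zero hi
  rw [Nat.succ_eq_add_one, pow_succ', ← mul_assoc, Al_mul_ABG F c hk, zero_mul]
lemma BGA_mul_Al (hs : 0 < s) : 𝐯 * 𝐚 = 0 := by
  rw [BGA, mul_assoc, Al_mul_Al, mul_smul_comm, mul_assoc, Ga_mul_ABG_pow_self F c hs,
    mul_zero, smul_zero]
lemma BGA_pow_mul_Al (hs : 0 < s) {i : ℕ} (hi : i ≠ 0) : 𝐯 ^ i * 𝐚 = 0 := by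
  obtain ⟨j, rfl⟩ := Nat.exists_eq_succ_of_ne_zero hi
  rw [Nat.succ_eq_add_one, pow_succ, mul_assoc, BGA_mul_Al F c hs, mul_zero]
lemma BGA_mul_ABG (hs : 0 < s) : 𝐯 * 𝐮 = 0 := by
  rw [ABG, ← mul_assoc, ← mul_assoc, BGA_mul_Al F c hs, zero_mul, zero_mul]
lemma ABG_mul_BGA : 𝐮 * 𝐯 = 0 := by
  rw [BGA, ← mul_assoc, ← mul_assoc, ABG_mul_Be, zero_mul, zero_mul]
lemma BGA_mul_ABG_pow (hs : 0 < s) {i : ℕ} (hi : i ≠ 0) : 𝐯 * 𝐮 ^ i = 0 := by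
  obtain ⟨j, rfl⟩ := Nat.exists_eq_succ_of_ne_zero hi
  rw [Nat.succ_eq_add_one, pow_succ', ← mul_assoc, BGA_mul_ABG F c hs, zero_mul]

lemma ABG_pow_succ_self (hk : 0 < k) : 𝐮 ^ (k + 1) = 0 := by
  rw [pow_succ', ABG_pow_eq_BGA_pow, ← Nat.sub_add_cancel hk, pow_succ', ← mul_assoc,
    Nat.sub_add_cancel hk, ABG_mul_BGA, zero_mul]
lemma BGA_pow_succ_self (hk : 0 < k) (hs : 0 < s) : 𝐯 ^ (k + 1) = 0 := by
  rw [pow_succ', ← ABG_pow_eq_BGA_pow, BGA_mul_ABG_pow F c hs hk.ne']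
lemma Be_mul_Et_pow {i : ℕ} (hi : i ≠ 0) : 𝐛 * 𝐡 ^ i = 0 := by
  obtain ⟨j, rfl⟩ := Nat.exists_eq_succ_of_ne_zero hi
  rw [Nat.succ_eq_add_one, pow_succ', ← mul_assoc, Be_mul_Et, zero_mul]
lemma Et_mul_GAB : 𝐡 * 𝐰 = 0 := by
  rw [GAB, ← mul_assoc, ← mul_assoc, Et_mul_Ga, zero_mul, zero_mul]
lemma GAB_mul_Et : 𝐰 * 𝐡 = 0 := by
  rw [GAB, mul_assoc, Be_mul_Et, mul_zero]
lemma Et_mul_GAB_pow {i : ℕ} (hi : i ≠ 0) : 𝐡 * 𝐰 ^ i = 0 := by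
  obtain ⟨j, rfl⟩ := Nat.exists_eq_succ_of_ne_zero hi
  rw [Nat.succ_eq_add_one, pow_succ', ← mul_assoc, Et_mul_GAB, zero_mul]
lemma Et_pow_succ_self (hk : 0 < k) : 𝐡 ^ (s + 1) = 0 := by
  rw [pow_succ', Et_pow_eq_GAB_pow, Et_mul_GAB_pow F c hk.ne']
lemma GAB_pow_succ_self (hs : 0 < s) : 𝐰 ^ (k + 1) = 0 := by
  rw [pow_succ', ← Et_pow_eq_GAB_pow, GAB, mul_assoc, Be_mul_Et_pow F c hs.ne', mul_zero]

lemma ABG_pow_eq_zero (hk : 0 < k) {i : ℕ} (hi : k < i) : 𝐮 ^ i = 0 :=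
  pow_eq_zero_of_le hi (ABG_pow_succ_self F c hk)
lemma BGA_pow_eq_zero (hk : 0 < k) (hs : 0 < s) {i : ℕ} (hi : k < i) : 𝐯 ^ i = 0 :=
  pow_eq_zero_of_le hi (BGA_pow_succ_self F c hk hs)
lemma GAB_pow_eq_zero (hs : 0 < s) {i : ℕ} (hi : k < i) : 𝐰 ^ i = 0 :=
  pow_eq_zero_of_le hi (GAB_pow_succ_self F c hs)
lemma Et_pow_eq_zero (hk : 0 < k) {i : ℕ} (hi : s < i) : 𝐡 ^ i = 0 :=
  pow_eq_zero_of_le hi (Et_pow_succ_self F c hk)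

lemma BGA_pow_self_mul_BeGa (hs : 0 < s) : 𝐯 ^ k * (𝐛 * 𝐠) = 0 := by
  rw [← BeGa_mul_ABG_pow, mul_assoc, Ga_mul_ABG_pow_self F c hs, mul_zero]

end Powers

section Filtration

/-- The families of standard paths; in each family the exponent ranges over `ℕ`. -/
inductive Family : Type
  | x1 | x2 | x3 | x4 | y2 | y3 | z1 | z2 | z3 | h

/-- The path with a given exponent in a family. -/
def path : Family → ℕ → DA F k s c
  | .x1, i => ε₁ * 𝐮 ^ i
  | .x2, i => 𝐮 ^ i * 𝐚
  | .x3, i => ε₁ * 𝐯 ^ i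
  | .x4, i => 𝐯 ^ i * (𝐛 * 𝐠)
  | .y2, i => 𝐮 ^ i * (𝐚 * 𝐛)
  | .y3, i => 𝐯 ^ i * 𝐛
  | .z1, i => 𝐰 ^ i * 𝐠
  | .z2, i => 𝐰 ^ i * (𝐠 * 𝐚)
  | .z3, i => 𝐰 ^ (i + 1)
  | .h, i => ε₂ * 𝐡 ^ i

/-- The length of a path. -/
def pathLength : Family → ℕ → ℕ
  | .x1, i => 3 * i
  | .x2, i => 3 * i + 1
  | .x3, i => 3 * i
  | .x4, i => 3 * i + 2
  | .y2, i => 3 * i + 2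
  | .y3, i => 3 * i + 1
  | .z1, i => 3 * i + 1
  | .z2, i => 3 * i + 2
  | .z3, i => 3 * i + 3
  | .h, i => i

/-- The families of paths starting at vertex 1. -/
def Family.startsAtOne : Family → Prop
  | .x1 | .x2 | .x3 | .x4 | .y2 | .y3 => True
  | .z1 | .z2 | .z3 | .h => False

/-- The subspace spanned by the paths of length at least `n`. -/
def pathSpan (n : ℕ) : Submodule F (DA F k s c) :=
  Submodule.span F {p | ∃ f i, n ≤ pathLength f i ∧ path F k s c f i = p}

variable {F k s c}

lemma path_mem_pathSpan {n : ℕ} (f : Family) (i : ℕ) (h : n ≤ pathLength f i) :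
    path F k s c f i ∈ pathSpan F k s c n :=
  Submodule.subset_span ⟨f, i, h, rfl⟩

lemma pathSpan_mono {m n : ℕ} (h : m ≤ n) : pathSpan F k s c n ≤ pathSpan F k s c m :=
  Submodule.span_mono fun _ ⟨f, i, hn, hp⟩ => ⟨f, i, h.trans hn, hp⟩

lemma E1_mul_path {f : Family} (hf : f.startsAtOne) (i : ℕ) :
    ε₁ * path F k s c f i = path F k s c f i := by
  cases f <;> simp only [Family.startsAtOne] at hf <;> simp only [path]
  · rw [← mul_assoc, E1_mul_E1]
  · rw [← Al_mul_BGA_pow, ← mul_assoc, E1_mul_Al]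
  · rw [← mul_assoc, E1_mul_E1]
  · rw [← BeGa_mul_ABG_pow]; simp only [← mul_assoc, E1_mul_Be]
  · rw [← AlBe_mul_GAB_pow]; simp only [← mul_assoc, E1_mul_Al]
  · rw [← Be_mul_GAB_pow]; simp only [← mul_assoc, E1_mul_Be]

lemma E2_mul_path {f : Family} (hf : ¬ f.startsAtOne) (i : ℕ) :
    ε₂ * path F k s c f i = path F k s c f i := by
  cases f <;> simp only [Family.startsAtOne, not_true_eq_false] at hf <;> simp only [path]
  · rw [← Ga_mul_ABG_pow, ← mul_assoc, E2_mul_Ga]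
  · rw [← mul_assoc (𝐰 ^ i), ← Ga_mul_ABG_pow]; simp only [← mul_assoc, E2_mul_Ga]
  · rw [E2_mul_GAB_pow _ _ i.succ_ne_zero]
  · rw [← mul_assoc, E2_mul_E2]

lemma mul_path_eq_zero_of_not_startsAtOne {x : DA F k s c} (hx : x * ε₂ = 0) {f : Family}
    (hf : ¬ f.startsAtOne) (i : ℕ) : x * path F k s c f i = 0 := by
  rw [← E2_mul_path hf, ← mul_assoc, hx, zero_mul]

lemma mul_path_eq_zero_of_startsAtOne {x : DA F k s c} (hx : x * ε₁ = 0) {f : Family}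
    (hf : f.startsAtOne) (i : ℕ) : x * path F k s c f i = 0 := by
  rw [← E1_mul_path hf, ← mul_assoc, hx, zero_mul]

lemma Al_mul_path_x1 (hk : 0 < k) {i : ℕ} (hi : i ≠ 0) : 𝐚 * path F k s c .x1 i = 0 := by
  rw [path, ← mul_assoc, Al_mul_E1, Al_mul_ABG_pow _ _ hk hi]
lemma Al_mul_path_x2 (hk : 0 < k) {i : ℕ} (hi : i ≠ 0) : 𝐚 * path F k s c .x2 i = 0 := by
  rw [path, ← mul_assoc, Al_mul_ABG_pow _ _ hk hi, zero_mul]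
lemma Al_mul_path_x3 (i : ℕ) : 𝐚 * path F k s c .x3 i = path F k s c .x2 i := by
  simp only [path]; rw [← mul_assoc, Al_mul_E1, Al_mul_BGA_pow]
lemma Al_mul_path_x4 (i : ℕ) : 𝐚 * path F k s c .x4 i = path F k s c .x1 (i + 1) := by
  simp only [path]
  rw [E1_mul_ABG_pow _ _ i.succ_ne_zero, ← mul_assoc, Al_mul_BGA_pow, mul_assoc, pow_succ, ABG,
    mul_assoc]
lemma Al_mul_path_y2 (hk : 0 < k) (i : ℕ) : 𝐚 * path F k s c .y2 i = 0 := by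
  rw [path]
  rcases eq_or_ne i 0 with rfl | hi
  · rw [pow_zero, one_mul, ← mul_assoc, Al_mul_Al, smul_mul_assoc, ABG_pow_mul_Be _ _ hk.ne',
      smul_zero]
  · rw [← mul_assoc, Al_mul_ABG_pow _ _ hk hi, zero_mul]
lemma Al_mul_path_y3 (i : ℕ) : 𝐚 * path F k s c .y3 i = path F k s c .y2 i := by
  simp only [path]; rw [← mul_assoc, Al_mul_BGA_pow, mul_assoc]

lemma Be_mul_path_z1 (i : ℕ) : 𝐛 * path F k s c .z1 i = path F k s c .x4 i := by
  simp only [path]; rw [← mul_assoc, Be_mul_GAB_pow, mul_assoc]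
lemma Be_mul_path_z2 (i : ℕ) : 𝐛 * path F k s c .z2 i = path F k s c .x3 (i + 1) := by
  simp only [path]
  rw [E1_mul_BGA_pow _ _ i.succ_ne_zero, ← mul_assoc, Be_mul_GAB_pow, mul_assoc, pow_succ, BGA,
    mul_assoc]
lemma Be_mul_path_z3 (i : ℕ) : 𝐛 * path F k s c .z3 i = path F k s c .y3 (i + 1) := by
  simp only [path]; rw [Be_mul_GAB_pow]
lemma Be_mul_path_h_zero : 𝐛 * path F k s c .h 0 = path F k s c .y3 0 := by
  simp [path, Be_mul_E2]
lemma Be_mul_path_h {i : ℕ} (hi : i ≠ 0) : 𝐛 * path F k s c .h i = 0 := by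
  rw [path, ← mul_assoc, Be_mul_E2, Be_mul_Et_pow _ _ hi]

lemma Ga_mul_path_x1 (i : ℕ) : 𝐠 * path F k s c .x1 i = path F k s c .z1 i := by
  simp only [path]; rw [← mul_assoc, Ga_mul_E1, Ga_mul_ABG_pow]
lemma Ga_mul_path_x2 (i : ℕ) : 𝐠 * path F k s c .x2 i = path F k s c .z2 i := by
  simp only [path]; rw [← mul_assoc, Ga_mul_ABG_pow, mul_assoc]
lemma Ga_mul_path_x3_zero : 𝐠 * path F k s c .x3 0 = path F k s c .z1 0 := by
  simp [path, Ga_mul_E1]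
lemma Ga_mul_path_x3 {i : ℕ} (hi : i ≠ 0) : 𝐠 * path F k s c .x3 i = 0 := by
  rw [path, ← mul_assoc, Ga_mul_E1, Ga_mul_BGA_pow _ _ hi]
lemma Ga_mul_path_x4 (i : ℕ) : 𝐠 * path F k s c .x4 i = 0 := by
  rw [path]
  rcases eq_or_ne i 0 with rfl | hi
  · rw [pow_zero, one_mul, ← mul_assoc, Ga_mul_Be, zero_mul]
  · rw [← mul_assoc, Ga_mul_BGA_pow _ _ hi, zero_mul]
lemma Ga_mul_path_y2 (i : ℕ) : 𝐠 * path F k s c .y2 i = path F k s c .z3 i := by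
  simp only [path]; rw [← mul_assoc, Ga_mul_ABG_pow, mul_assoc, pow_succ, GAB, mul_assoc]
lemma Ga_mul_path_y3 (i : ℕ) : 𝐠 * path F k s c .y3 i = 0 := by
  rw [path]
  rcases eq_or_ne i 0 with rfl | hi
  · rw [pow_zero, one_mul, Ga_mul_Be]
  · rw [← mul_assoc, Ga_mul_BGA_pow _ _ hi, zero_mul]

lemma Et_mul_path_z1 (i : ℕ) : 𝐡 * path F k s c .z1 i = 0 := by
  rw [path, ← Ga_mul_ABG_pow, ← mul_assoc, Et_mul_Ga, zero_mul]
lemma Et_mul_path_z2 (i : ℕ) : 𝐡 * path F k s c .z2 i = 0 := by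
  rw [← Ga_mul_path_x2, ← mul_assoc, Et_mul_Ga, zero_mul]
lemma Et_mul_path_z3 (i : ℕ) : 𝐡 * path F k s c .z3 i = 0 := by
  rw [path, Et_mul_GAB_pow _ _ i.succ_ne_zero]
lemma Et_mul_path_h (i : ℕ) : 𝐡 * path F k s c .h i = path F k s c .h (i + 1) := by
  simp only [path]; rw [E2_mul_Et_pow _ _ i.succ_ne_zero, ← mul_assoc, Et_mul_E2, pow_succ']

lemma Al_mul_path_mem (hk : 0 < k) (f : Family) (i : ℕ) :
    𝐚 * path F k s c f i ∈ pathSpan F k s c (pathLength f i + 1) := by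
  by_cases hf : f.startsAtOne
  · cases f <;> simp only [Family.startsAtOne] at hf
    · rcases eq_or_ne i 0 with rfl | hi
      · have := path_mem_pathSpan (F := F) (k := k) (s := s) (c := c) (n := 1) .x2 0 le_rfl
        simpa [path, pathLength, Al_mul_E1] using this
      · rw [Al_mul_path_x1 hk hi]; exact zero_mem _
    · rcases eq_or_ne i 0 with rfl | hi
      · have := path_mem_pathSpan (F := F) (k := k) (s := s) (c := c) (n := 2) .x1 k
          (by simp only [pathLength]; omega)
        rw [path, E1_mul_ABG_pow _ _ hk.ne'] at this
        simpa [path, pathLength, Al_mul_Al] using Submodule.smul_mem _ c this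
      · rw [Al_mul_path_x2 hk hi]; exact zero_mem _
    · rw [Al_mul_path_x3]; exact path_mem_pathSpan _ _ (by simp only [pathLength]; omega)
    · rw [Al_mul_path_x4]; exact path_mem_pathSpan _ _ (by simp only [pathLength]; omega)
    · rw [Al_mul_path_y2 hk]; exact zero_mem _
    · rw [Al_mul_path_y3]; exact path_mem_pathSpan _ _ (by simp only [pathLength]; omega)
  · rw [mul_path_eq_zero_of_not_startsAtOne (Al_mul_E2 F k s c) hf]; exact zero_mem _

lemma Be_mul_path_mem (f : Family) (i : ℕ) :
    𝐛 * path F k s c f i ∈ pathSpan F k s c (pathLength f i + 1) := by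
  by_cases hf : f.startsAtOne
  · rw [mul_path_eq_zero_of_startsAtOne (Be_mul_E1 F k s c) hf]; exact zero_mem _
  · cases f <;> simp only [Family.startsAtOne, not_true_eq_false] at hf
    · rw [Be_mul_path_z1]; exact path_mem_pathSpan _ _ (by simp only [pathLength]; omega)
    · rw [Be_mul_path_z2]; exact path_mem_pathSpan _ _ (by simp only [pathLength]; omega)
    · rw [Be_mul_path_z3]; exact path_mem_pathSpan _ _ (by simp only [pathLength]; omega)
    · rcases eq_or_ne i 0 with rfl | hi
      · rw [Be_mul_path_h_zero]; exact path_mem_pathSpan _ _ (by simp only [pathLength]; omega)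
      · rw [Be_mul_path_h hi]; exact zero_mem _

lemma Ga_mul_path_mem (f : Family) (i : ℕ) :
    𝐠 * path F k s c f i ∈ pathSpan F k s c (pathLength f i + 1) := by
  by_cases hf : f.startsAtOne
  · cases f <;> simp only [Family.startsAtOne] at hf
    · rw [Ga_mul_path_x1]; exact path_mem_pathSpan _ _ (by simp only [pathLength]; omega)
    · rw [Ga_mul_path_x2]; exact path_mem_pathSpan _ _ (by simp only [pathLength]; omega)
    · rcases eq_or_ne i 0 with rfl | hi
      · rw [Ga_mul_path_x3_zero]; exact path_mem_pathSpan _ _ (by simp only [pathLength]; omega)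
      · rw [Ga_mul_path_x3 hi]; exact zero_mem _
    · rw [Ga_mul_path_x4]; exact zero_mem _
    · rw [Ga_mul_path_y2]; exact path_mem_pathSpan _ _ (by simp only [pathLength]; omega)
    · rw [Ga_mul_path_y3]; exact zero_mem _
  · rw [mul_path_eq_zero_of_not_startsAtOne (Ga_mul_E2 F k s c) hf]; exact zero_mem _

lemma Et_mul_path_mem (f : Family) (i : ℕ) :
    𝐡 * path F k s c f i ∈ pathSpan F k s c (pathLength f i + 1) := by
  by_cases hf : f.startsAtOne
  · rw [mul_path_eq_zero_of_startsAtOne (Et_mul_E1 F k s c) hf]; exact zero_mem _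
  · cases f <;> simp only [Family.startsAtOne, not_true_eq_false] at hf
    · rw [Et_mul_path_z1]; exact zero_mem _
    · rw [Et_mul_path_z2]; exact zero_mem _
    · rw [Et_mul_path_z3]; exact zero_mem _
    · rw [Et_mul_path_h]; exact path_mem_pathSpan _ _ (by simp only [pathLength]; omega)

lemma E1_mul_path_mem (f : Family) (i : ℕ) :
    ε₁ * path F k s c f i ∈ pathSpan F k s c (pathLength f i) := by
  by_cases hf : f.startsAtOne
  · rw [E1_mul_path hf]; exact path_mem_pathSpan _ _ le_rfl
  · rw [mul_path_eq_zero_of_not_startsAtOne (E1_mul_E2 F k s c) hf]; exact zero_mem _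

lemma E2_mul_path_mem (f : Family) (i : ℕ) :
    ε₂ * path F k s c f i ∈ pathSpan F k s c (pathLength f i) := by
  by_cases hf : f.startsAtOne
  · rw [mul_path_eq_zero_of_startsAtOne (E2_mul_E1 F k s c) hf]; exact zero_mem _
  · rw [E2_mul_path hf]; exact path_mem_pathSpan _ _ le_rfl

lemma mul_mem_pathSpan_of_path {x : DA F k s c} {d : ℕ}
    (hx : ∀ f i, x * path F k s c f i ∈ pathSpan F k s c (pathLength f i + d))
    {n : ℕ} {y : DA F k s c} (hy : y ∈ pathSpan F k s c n) :
    x * y ∈ pathSpan F k s c (n + d) := by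
  induction hy using Submodule.span_induction with
  | mem y hy =>
    obtain ⟨f, i, hn, rfl⟩ := hy
    exact pathSpan_mono (by omega) (hx f i)
  | zero => rw [mul_zero]; exact zero_mem _
  | add y z _ _ hy hz => rw [mul_add]; exact add_mem hy hz
  | smul r y _ hy => rw [mul_smul_comm]; exact Submodule.smul_mem _ r hy

variable (F k s c) in
/-- The arrows of the quiver. -/
def arrows : Set (DA F k s c) := {𝐚, 𝐛, 𝐠, 𝐡}

lemma arrow_mul_mem_pathSpan (hk : 0 < k) {x : DA F k s c} (hx : x ∈ arrows F k s c) {n : ℕ}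
    {y : DA F k s c} (hy : y ∈ pathSpan F k s c n) : x * y ∈ pathSpan F k s c (n + 1) := by
  rcases hx with rfl | rfl | rfl | rfl
  · exact mul_mem_pathSpan_of_path (Al_mul_path_mem hk) hy
  · exact mul_mem_pathSpan_of_path Be_mul_path_mem hy
  · exact mul_mem_pathSpan_of_path Ga_mul_path_mem hy
  · exact mul_mem_pathSpan_of_path Et_mul_path_mem hy

/-- An induction principle: a property holds on the algebra if it holds for the arrows and the
trivial paths and is stable under linear combinations and products. -/
lemma DA_induction {P : DA F k s c → Prop} (h1 : P ε₁) (h2 : P ε₂)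
    (ha : ∀ x ∈ arrows F k s c, P x)
    (hr : ∀ r : F, P (algebraMap F _ r)) (hadd : ∀ x y, P x → P y → P (x + y))
    (hmul : ∀ x y, P x → P y → P (x * y)) (x : DA F k s c) : P x := by
  obtain ⟨y, rfl⟩ := RingQuot.mkAlgHom_surjective F (Rel F k s c) x
  change P (mk F k s c y)
  induction y using FreeAlgebra.induction with
  | grade0 r => rw [AlgHom.commutes]; exact hr r
  | grade1 t =>
    cases t
    · exact h1
    · exact h2
    · exact ha 𝐚 (by simp [arrows])
    · exact ha 𝐛 (by simp [arrows])
    · exact ha 𝐠 (by simp [arrows])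
    · exact ha 𝐡 (by simp [arrows])
  | mul a b ha hb => rw [map_mul]; exact hmul _ _ ha hb
  | add a b ha hb => rw [map_add]; exact hadd _ _ ha hb

lemma mul_mem_pathSpan (hk : 0 < k) (x : DA F k s c) {n : ℕ} {y : DA F k s c}
    (hy : y ∈ pathSpan F k s c n) : x * y ∈ pathSpan F k s c n := by
  induction x using DA_induction generalizing y with
  | h1 => exact mul_mem_pathSpan_of_path (d := 0) E1_mul_path_mem hy
  | h2 => exact mul_mem_pathSpan_of_path (d := 0) E2_mul_path_mem hy
  | ha x hx => exact pathSpan_mono n.le_succ (arrow_mul_mem_pathSpan hk hx hy)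
  | hr r => rw [← Algebra.smul_def]; exact Submodule.smul_mem _ r hy
  | hadd x z hx hz => rw [add_mul]; exact add_mem (hx hy) (hz hy)
  | hmul x z hx hz => rw [mul_assoc]; exact hx (hz hy)

lemma one_mem_pathSpan_zero : 1 ∈ pathSpan F k s c 0 := by
  rw [← E1_add_E2]
  refine add_mem ?_ ?_
  · simpa [path] using path_mem_pathSpan (F := F) (k := k) (s := s) (c := c) .x1 0 (Nat.zero_le _)
  · simpa [path] using path_mem_pathSpan (F := F) (k := k) (s := s) (c := c) .h 0 (Nat.zero_le _)

lemma span_path_eq_top (hk : 0 < k) : pathSpan F k s c 0 = ⊤ :=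
  eq_top_iff.2 fun x _ => by simpa using mul_mem_pathSpan hk x one_mem_pathSpan_zero

lemma path_eq_zero (hk : 0 < k) (hs : 0 < s) (f : Family) {i : ℕ} (hi : k + s < i) :
    path F k s c f i = 0 := by
  cases f <;> rw [path]
  · rw [ABG_pow_eq_zero _ _ hk (by omega), mul_zero]
  · rw [ABG_pow_eq_zero _ _ hk (by omega), zero_mul]
  · rw [BGA_pow_eq_zero _ _ hk hs (by omega), mul_zero]
  · rw [BGA_pow_eq_zero _ _ hk hs (by omega), zero_mul]
  · rw [ABG_pow_eq_zero _ _ hk (by omega), zero_mul]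
  · rw [BGA_pow_eq_zero _ _ hk hs (by omega), zero_mul]
  · rw [GAB_pow_eq_zero _ _ hs (by omega), zero_mul]
  · rw [GAB_pow_eq_zero _ _ hs (by omega), zero_mul]
  · rw [GAB_pow_eq_zero _ _ hs (by omega)]
  · rw [Et_pow_eq_zero _ _ hk (by omega), mul_zero]

lemma pathSpan_eq_bot (hk : 0 < k) (hs : 0 < s) :
    pathSpan F k s c (3 * (k + s) + 4) = ⊥ := by
  rw [pathSpan, Submodule.span_eq_bot]
  rintro _ ⟨f, i, hn, rfl⟩
  refine path_eq_zero hk hs f ?_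
  cases f <;> simp only [pathLength] at hn <;> omega

lemma mul_arrow_isNilpotent (hk : 0 < k) (hs : 0 < s) (y : DA F k s c) {x : DA F k s c}
    (hx : x ∈ arrows F k s c) : IsNilpotent (y * x) := by
  have h (n : ℕ) : (y * x) ^ n ∈ pathSpan F k s c n := by
    induction n with
    | zero => rw [pow_zero]; exact one_mem_pathSpan_zero
    | succ n ih =>
      rw [pow_succ', mul_assoc]
      exact mul_mem_pathSpan hk _ (arrow_mul_mem_pathSpan hk hx ih)
  refine ⟨3 * (k + s) + 4, ?_⟩
  simpa [pathSpan_eq_bot hk hs] using h (3 * (k + s) + 4)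

/-- Arrows annihilate the socle. -/
lemma arrow_mul_eq_zero_of_mem_socle (hk : 0 < k) (hs : 0 < s) {x : DA F k s c}
    (hx : x ∈ arrows F k s c) {p : DA F k s c} (hp : p ∈ socle (DA F k s c)) : x * p = 0 := by
  rw [socle, sSup_eq_iSup'] at hp
  induction hp using Submodule.iSup_induction' with
  | zero => rw [mul_zero]
  | add y z _ _ hy hz => rw [mul_add, hy, hz, add_zero]
  | mem S m hm =>
    obtain ⟨S, hS : IsAtom S⟩ := S
    by_contra hne
    have hle : Submodule.span (DA F k s c) {x * m} ≤ S := by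
      rw [Submodule.span_singleton_le_iff_mem]; exact S.smul_mem x hm
    have heq := (hS.le_iff.1 hle).resolve_left (by simpa using hne)
    have hm' : m ∈ Submodule.span (DA F k s c) {x * m} := heq ▸ hm
    obtain ⟨y, hy⟩ := Submodule.mem_span_singleton.1 hm'
    rw [smul_eq_mul, ← mul_assoc] at hy
    have hpow (n : ℕ) : (y * x) ^ n * m = m := by
      induction n with
      | zero => simp
      | succ n ih => rw [pow_succ, mul_assoc, hy, ih]
    obtain ⟨n, hn⟩ := mul_arrow_isNilpotent hk hs y hx
    have := hpow n
    rw [hn, zero_mul] at this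
    exact hne (by rw [← this, mul_zero])

lemma notMem_socle_of_mul_arrow_mul_ne_zero (hk : 0 < k) (hs : 0 < s) (y : DA F k s c)
    {x : DA F k s c} (hx : x ∈ arrows F k s c) {p : DA F k s c} (h : y * x * p ≠ 0) :
    p ∉ socle (DA F k s c) := fun hp => by
  rw [mul_assoc, arrow_mul_eq_zero_of_mem_socle hk hs hx hp, mul_zero] at h
  exact h rfl

/-- A nonzero element all of whose left multiples are scalar multiples of it lies in the socle. -/
lemma mem_socle_of_mul_mem_span {p : DA F k s c} (hp : p ≠ 0)
    (h : ∀ y : DA F k s c, ∃ r : F, y * p = r • p) : p ∈ socle (DA F k s c) := by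
  have hat : IsAtom (Submodule.span (DA F k s c) {p}) := by
    refine ⟨by simpa using hp, fun T hT => ?_⟩
    by_contra hne
    obtain ⟨m, hm, hm0⟩ := T.ne_bot_iff.1 hne
    obtain ⟨y, rfl⟩ := Submodule.mem_span_singleton.1 (hT.le hm)
    obtain ⟨r, hr⟩ := h y
    have hr0 : r ≠ 0 := by
      rintro rfl
      exact hm0 (by simpa using hr)
    refine hT.not_ge ?_
    rw [Submodule.span_singleton_le_iff_mem]
    have := T.smul_mem (algebraMap F (DA F k s c) r⁻¹) hm
    rw [smul_eq_mul, smul_eq_mul, hr, ← Algebra.smul_def, smul_smul, inv_mul_cancel₀ hr0,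
      one_smul] at this
    exact this
  exact Submodule.mem_sSup_of_mem (S := {S | IsAtom S}) hat (Submodule.mem_span_singleton_self p)

lemma exists_mul_eq_smul {p : DA F k s c} (h1 : ε₁ * p = p ∨ ε₁ * p = 0)
    (ha : ∀ x ∈ arrows F k s c, x * p = 0) (y : DA F k s c) : ∃ r : F, y * p = r • p := by
  induction y using DA_induction with
  | h1 => rcases h1 with h | h; exacts [⟨1, by simp [h]⟩, ⟨0, by simp [h]⟩]
  | h2 =>
    rw [eq_sub_of_add_eq' (E1_add_E2 F k s c), sub_mul, one_mul]
    rcases h1 with h | h; exacts [⟨0, by simp [h]⟩, ⟨1, by simp [h]⟩]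
  | ha x hx => exact ⟨0, by simp [ha x hx]⟩
  | hr r => exact ⟨r, (Algebra.smul_def _ _).symm⟩
  | hadd x z hx hz =>
    obtain ⟨a, ha⟩ := hx
    obtain ⟨b, hb⟩ := hz
    exact ⟨a + b, by rw [add_mul, ha, hb, add_smul]⟩
  | hmul x z hx hz =>
    obtain ⟨a, ha⟩ := hx
    obtain ⟨b, hb⟩ := hz
    exact ⟨b * a, by rw [mul_assoc, hb, mul_smul_comm, ha, smul_smul]⟩

end Filtration

section SocleForm

variable {F k s c} {ψ : DA F k s c →ₗ[F] F}

lemma ABG_pow_self_mem_BB : 𝐮 ^ k ∈ BB F k s c := by simp [BB, B11]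

lemma Et_pow_self_mem_BB (hs : 0 < s) : 𝐡 ^ s ∈ BB F k s c :=
  Or.inr (Or.inr ⟨s, ⟨hs, le_rfl⟩, rfl⟩)

lemma ne_zero_of_mem_BB (hψ : SoclePsi F k s c ψ) {p : DA F k s c} (hp : p ∈ BB F k s c) :
    p ≠ 0 := by
  rintro rfl
  simpa using (hψ 0 hp).1 (zero_mem _)

lemma ABG_pow_self_ne_zero (hψ : SoclePsi F k s c ψ) : 𝐮 ^ k ≠ 0 :=
  ne_zero_of_mem_BB hψ ABG_pow_self_mem_BB

lemma Et_pow_self_ne_zero (hs : 0 < s) (hψ : SoclePsi F k s c ψ) : 𝐡 ^ s ≠ 0 :=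
  ne_zero_of_mem_BB hψ (Et_pow_self_mem_BB hs)

lemma psi_ABG_pow_self (hk : 0 < k) (hs : 0 < s) (hψ : SoclePsi F k s c ψ) :
    ψ (𝐮 ^ k) = 1 := by
  refine (hψ _ ABG_pow_self_mem_BB).1
    (mem_socle_of_mul_mem_span (ABG_pow_self_ne_zero hψ) (exists_mul_eq_smul ?_ ?_))
  · exact Or.inl (E1_mul_ABG_pow _ _ hk.ne')
  · rintro x (rfl | rfl | rfl | rfl)
    · exact Al_mul_ABG_pow _ _ hk hk.ne'
    · rw [← E1_mul_ABG_pow _ _ hk.ne', ← mul_assoc, Be_mul_E1, zero_mul]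
    · exact Ga_mul_ABG_pow_self _ _ hs
    · rw [← E1_mul_ABG_pow _ _ hk.ne', ← mul_assoc, Et_mul_E1, zero_mul]

lemma psi_Et_pow_self (hk : 0 < k) (hs : 0 < s) (hψ : SoclePsi F k s c ψ) :
    ψ (𝐡 ^ s) = 1 := by
  have h2 := E2_mul_Et_pow F (k := k) (s := s) c hs.ne'
  refine (hψ _ (Et_pow_self_mem_BB hs)).1
    (mem_socle_of_mul_mem_span (Et_pow_self_ne_zero hs hψ) (exists_mul_eq_smul ?_ ?_))
  · right
    rw [← h2, ← mul_assoc, E1_mul_E2, zero_mul]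
  · rintro x (rfl | rfl | rfl | rfl)
    · rw [← h2, ← mul_assoc, Al_mul_E2, zero_mul]
    · exact Be_mul_Et_pow _ _ hs.ne'
    · rw [← h2, ← mul_assoc, Ga_mul_E2, zero_mul]
    · rw [Et_pow_eq_GAB_pow, Et_mul_GAB_pow _ _ hk.ne']

lemma psi_eq_zero_of_mul_arrow_mul (hk : 0 < k) (hs : 0 < s) (hψ : SoclePsi F k s c ψ)
    {p : DA F k s c} (hp : p ∈ BB F k s c) (y : DA F k s c) {x : DA F k s c}
    (hx : x ∈ arrows F k s c) (h : y * x * p = 𝐮 ^ k ∨ y * x * p = 𝐡 ^ s) : ψ p = 0 := by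
  refine (hψ p hp).2 (notMem_socle_of_mul_arrow_mul_ne_zero hk hs y hx ?_)
  rcases h with h | h <;> rw [h]
  exacts [ABG_pow_self_ne_zero hψ, Et_pow_self_ne_zero hs hψ]

lemma path_mem_BB (f : Family) {i : ℕ} (hi : i < k) (hz : f = .z3 → i + 1 < k)
    (hh : f = .h → i ≤ s) : path F k s c f i ∈ BB F k s c := by
  have hIcc (h0 : i ≠ 0) : i ∈ Set.Icc 1 (k - 1) := ⟨by omega, by omega⟩
  rcases eq_or_ne i 0 with rfl | h0
  · cases f
    case z3 =>
      exact Or.inr (Or.inl (Or.inr ⟨1, ⟨le_rfl, by have := hz rfl; omega⟩, by simp [path]⟩))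
    all_goals simp [path, BB, B11, B12, B21, B22]
  · cases f <;> rw [path]
    · rw [E1_mul_ABG_pow _ _ h0]
      exact Or.inl (Or.inl (Or.inl (Or.inl (Or.inl (Or.inl (Or.inr ⟨i, hIcc h0, rfl⟩))))))
    · exact Or.inl (Or.inl (Or.inl (Or.inl (Or.inl (Or.inr ⟨i, hIcc h0, rfl⟩)))))
    · rw [E1_mul_BGA_pow _ _ h0]
      exact Or.inl (Or.inl (Or.inl (Or.inl (Or.inr ⟨i, hIcc h0, rfl⟩))))
    · exact Or.inl (Or.inl (Or.inl (Or.inr ⟨i, hIcc h0, rfl⟩)))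
    · exact Or.inl (Or.inl (Or.inr (Or.inr ⟨i, hIcc h0, rfl⟩)))
    · exact Or.inl (Or.inl (Or.inr (Or.inl (Or.inr ⟨i, hIcc h0, rfl⟩))))
    · exact Or.inl (Or.inr (Or.inl (Or.inr ⟨i, hIcc h0, rfl⟩)))
    · exact Or.inl (Or.inr (Or.inr ⟨i, hIcc h0, rfl⟩))
    · exact Or.inr (Or.inl (Or.inr ⟨i + 1, ⟨by omega, by have := hz rfl; omega⟩, rfl⟩))
    · rw [E2_mul_Et_pow _ _ h0]
      exact Or.inr (Or.inr ⟨i, ⟨by omega, hh rfl⟩, rfl⟩)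

lemma path_h_mem_BB {i : ℕ} (hi : i ≤ s) : path F k s c .h i ∈ BB F k s c := by
  rcases eq_or_ne i 0 with rfl | h0
  · simp [path, BB, B22]
  · rw [path, E2_mul_Et_pow _ _ h0]
    exact Or.inr (Or.inr ⟨i, ⟨by omega, hi⟩, rfl⟩)

lemma psi_path_x1 (hk : 0 < k) (hs : 0 < s) (hψ : SoclePsi F k s c ψ) (i : ℕ) :
    ψ (path F k s c .x1 i) = if i = k then 1 else 0 := by
  rcases lt_trichotomy i k with h | rfl | h
  · rw [if_neg h.ne]
    obtain ⟨j, hj⟩ : ∃ j, k = j + 1 + i := ⟨k - i - 1, by omega⟩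
    refine psi_eq_zero_of_mul_arrow_mul hk hs hψ (path_mem_BB _ h (by simp) (by simp))
      (𝐮 ^ j * (𝐚 * 𝐛)) (x := 𝐠) (by simp [arrows]) (Or.inl ?_)
    have : 𝐮 ^ j * (𝐚 * 𝐛) * 𝐠 = 𝐮 ^ (j + 1) := by rw [pow_succ, ABG, mul_assoc]
    rw [this, path, E1_mul_ABG_pow_comm, ← mul_assoc, ← pow_add, ← hj, ← E1_mul_ABG_pow_comm,
      E1_mul_ABG_pow _ _ hk.ne']
  · rw [if_pos rfl, path, E1_mul_ABG_pow _ _ hk.ne', psi_ABG_pow_self hk hs hψ]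
  · rw [if_neg h.ne', path, ABG_pow_eq_zero _ _ hk h, mul_zero, map_zero]

lemma psi_path_x3 (hk : 0 < k) (hs : 0 < s) (hψ : SoclePsi F k s c ψ) (i : ℕ) :
    ψ (path F k s c .x3 i) = if i = k then 1 else 0 := by
  rcases lt_trichotomy i k with h | rfl | h
  · rw [if_neg h.ne]
    obtain ⟨j, hj⟩ : ∃ j, k = j + 1 + i := ⟨k - i - 1, by omega⟩
    refine psi_eq_zero_of_mul_arrow_mul hk hs hψ (path_mem_BB _ h (by simp) (by simp))
      (𝐯 ^ j * (𝐛 * 𝐠)) (x := 𝐚) (by simp [arrows]) (Or.inl ?_)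
    have : 𝐯 ^ j * (𝐛 * 𝐠) * 𝐚 = 𝐯 ^ (j + 1) := by rw [pow_succ, BGA, mul_assoc]
    rw [this, path, E1_mul_BGA_pow_comm, ← mul_assoc, ← pow_add, ← hj, ← E1_mul_BGA_pow_comm,
      E1_mul_BGA_pow _ _ hk.ne', ABG_pow_eq_BGA_pow]
  · rw [if_pos rfl, path, E1_mul_BGA_pow _ _ hk.ne', ← ABG_pow_eq_BGA_pow,
      psi_ABG_pow_self hk hs hψ]
  · rw [if_neg h.ne', path, BGA_pow_eq_zero _ _ hk hs h, mul_zero, map_zero]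

lemma psi_path_z3 (hk : 0 < k) (hs : 0 < s) (hψ : SoclePsi F k s c ψ) (i : ℕ) :
    ψ (path F k s c .z3 i) = if i + 1 = k then 1 else 0 := by
  rcases lt_trichotomy (i + 1) k with h | h | h
  · rw [if_neg h.ne]
    obtain ⟨j, hj⟩ : ∃ j, k = j + 1 + (i + 1) := ⟨k - i - 2, by omega⟩
    refine psi_eq_zero_of_mul_arrow_mul hk hs hψ (path_mem_BB _ (by omega) (by simp [h]) (by simp))
      (𝐰 ^ j * (𝐠 * 𝐚)) (x := 𝐛) (by simp [arrows]) (Or.inr ?_)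
    have : 𝐰 ^ j * (𝐠 * 𝐚) * 𝐛 = 𝐰 ^ (j + 1) := by rw [pow_succ, GAB, mul_assoc]
    rw [this, path, ← pow_add, ← hj, Et_pow_eq_GAB_pow]
  · rw [if_pos h, path, h, ← Et_pow_eq_GAB_pow, psi_Et_pow_self hk hs hψ]
  · rw [if_neg h.ne', path, GAB_pow_eq_zero _ _ hs h, map_zero]

lemma psi_path_h (hk : 0 < k) (hs : 0 < s) (hψ : SoclePsi F k s c ψ) (i : ℕ) :
    ψ (path F k s c .h i) = if i = s then 1 else 0 := by
  rcases lt_trichotomy i s with h | rfl | h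
  · rw [if_neg h.ne]
    obtain ⟨j, hj⟩ : ∃ j, s = j + 1 + i := ⟨s - i - 1, by omega⟩
    refine psi_eq_zero_of_mul_arrow_mul hk hs hψ (path_h_mem_BB h.le)
      (𝐡 ^ j) (x := 𝐡) (by simp [arrows]) (Or.inr ?_)
    rw [← pow_succ, path, E2_mul_Et_pow_comm, ← mul_assoc, ← pow_add, ← hj, ← E2_mul_Et_pow_comm,
      E2_mul_Et_pow _ _ hs.ne']
  · rw [if_pos rfl, path, E2_mul_Et_pow _ _ hs.ne', psi_Et_pow_self hk hs hψ]
  · rw [if_neg h.ne', path, Et_pow_eq_zero _ _ hk h, mul_zero, map_zero]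

lemma psi_path_x2 (hk : 0 < k) (hs : 0 < s) (hψ : SoclePsi F k s c ψ) (i : ℕ) :
    ψ (path F k s c .x2 i) = 0 := by
  rcases lt_or_ge i k with h | h
  · obtain ⟨j, hj⟩ : ∃ j, k = j + i + 1 := ⟨k - i - 1, by omega⟩
    refine psi_eq_zero_of_mul_arrow_mul hk hs hψ (path_mem_BB _ h (by simp) (by simp))
      (𝐯 ^ j * 𝐛) (x := 𝐠) (by simp [arrows]) (Or.inl ?_)
    rw [path, mul_assoc (𝐯 ^ j), mul_assoc (𝐯 ^ j), ← mul_assoc (𝐛 * 𝐠), BeGa_mul_ABG_pow,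
      mul_assoc (𝐯 ^ i), ← mul_assoc, ← pow_add]
    change _ * 𝐯 = _
    rw [← pow_succ, ← hj, ABG_pow_eq_BGA_pow]
  · rw [path, ← Al_mul_BGA_pow]
    have : 𝐚 * 𝐯 ^ k = 0 := by rw [← ABG_pow_eq_BGA_pow, Al_mul_ABG_pow _ _ hk hk.ne']
    rw [← Nat.add_sub_cancel' h, pow_add, ← mul_assoc, this, zero_mul, map_zero]

lemma psi_path_x4 (hk : 0 < k) (hs : 0 < s) (hψ : SoclePsi F k s c ψ) (i : ℕ) :
    ψ (path F k s c .x4 i) = 0 := by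
  rcases lt_or_ge i k with h | h
  · obtain ⟨j, hj⟩ : ∃ j, k = j + (i + 1) := ⟨k - i - 1, by omega⟩
    refine psi_eq_zero_of_mul_arrow_mul hk hs hψ (path_mem_BB _ h (by simp) (by simp))
      (𝐮 ^ j) (x := 𝐚) (by simp [arrows]) (Or.inl ?_)
    rw [mul_assoc, Al_mul_path_x4, path, E1_mul_ABG_pow _ _ i.succ_ne_zero, ← pow_add, ← hj]
  · rw [path, ← Nat.sub_add_cancel h, pow_add, mul_assoc, BGA_pow_self_mul_BeGa _ _ hs, mul_zero,
      map_zero]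

lemma psi_path_of_off_diagonal (hk : 0 < k) (hs : 0 < s) (hψ : SoclePsi F k s c ψ)
    {f : Family} (hf : f = .y2 ∨ f = .y3 ∨ f = .z1 ∨ f = .z2) (i : ℕ) :
    ψ (path F k s c f i) = 0 := by
  rcases lt_or_ge i k with h | h
  · obtain ⟨j, hj⟩ : ∃ j, k = j + (i + 1) := ⟨k - i - 1, by omega⟩
    rcases hf with rfl | rfl | rfl | rfl
    · refine psi_eq_zero_of_mul_arrow_mul hk hs hψ (path_mem_BB _ h (by simp) (by simp))
        (𝐰 ^ j) (x := 𝐠) (by simp [arrows]) (Or.inr ?_)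
      rw [mul_assoc, Ga_mul_path_y2, path, ← pow_add, ← hj, Et_pow_eq_GAB_pow]
    · refine psi_eq_zero_of_mul_arrow_mul hk hs hψ (path_mem_BB _ h (by simp) (by simp))
        (𝐰 ^ j * 𝐠) (x := 𝐚) (by simp [arrows]) (Or.inr ?_)
      rw [mul_assoc, Al_mul_path_y3, mul_assoc, Ga_mul_path_y2, path, ← pow_add, ← hj,
        Et_pow_eq_GAB_pow]
    · refine psi_eq_zero_of_mul_arrow_mul hk hs hψ (path_mem_BB _ h (by simp) (by simp))
        (𝐮 ^ j * 𝐚) (x := 𝐛) (by simp [arrows]) (Or.inl ?_)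
      rw [mul_assoc, Be_mul_path_z1, mul_assoc, Al_mul_path_x4, path,
        E1_mul_ABG_pow _ _ i.succ_ne_zero, ← pow_add, ← hj]
    · refine psi_eq_zero_of_mul_arrow_mul hk hs hψ (path_mem_BB _ h (by simp) (by simp))
        (𝐯 ^ j) (x := 𝐛) (by simp [arrows]) (Or.inl ?_)
      rw [mul_assoc, Be_mul_path_z2, path, E1_mul_BGA_pow _ _ i.succ_ne_zero, ← pow_add, ← hj,
        ABG_pow_eq_BGA_pow]
  · have h0 : 𝐰 ^ k * 𝐠 = 0 := by rw [← Ga_mul_ABG_pow, Ga_mul_ABG_pow_self _ _ hs]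
    have h1 : 𝐯 ^ k * 𝐛 = 0 := by rw [← ABG_pow_eq_BGA_pow, ABG_pow_mul_Be _ _ hk.ne']
    have h2 : 𝐮 ^ k * (𝐚 * 𝐛) = 0 := by
      rw [← mul_assoc, ← Al_mul_BGA_pow, mul_assoc, h1, mul_zero]
    rw [← Nat.sub_add_cancel h]
    rcases hf with rfl | rfl | rfl | rfl <;> rw [path, pow_add, mul_assoc]
    · rw [h2, mul_zero, map_zero]
    · rw [h1, mul_zero, map_zero]
    · rw [h0, mul_zero, map_zero]
    · rw [← mul_assoc (𝐰 ^ k), h0, zero_mul, mul_zero, map_zero]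

end SocleForm

section Symmetry

variable {F k s c} {ψ : DA F k s c →ₗ[F] F}

/-- The families of paths ending at vertex 1. -/
def Family.endsAtOne : Family → Prop
  | .x1 | .x2 | .x3 | .x4 | .z1 | .z2 => True
  | .y2 | .y3 | .z3 | .h => False

lemma path_mul_E1 {f : Family} (hf : f.endsAtOne) (i : ℕ) :
    path F k s c f i * ε₁ = path F k s c f i := by
  cases f <;> simp only [Family.endsAtOne] at hf <;> simp only [path]
  · rw [E1_mul_ABG_pow_comm, mul_assoc, E1_mul_E1]
  · rw [mul_assoc, Al_mul_E1]
  · rw [E1_mul_BGA_pow_comm, mul_assoc, E1_mul_E1]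
  · simp only [mul_assoc, Ga_mul_E1]
  · rw [mul_assoc, Ga_mul_E1]
  · simp only [mul_assoc, Al_mul_E1]

lemma path_mul_E2 {f : Family} (hf : ¬ f.endsAtOne) (i : ℕ) :
    path F k s c f i * ε₂ = path F k s c f i := by
  cases f <;> simp only [Family.endsAtOne, not_true_eq_false] at hf <;> simp only [path]
  · simp only [mul_assoc, Be_mul_E2]
  · rw [mul_assoc, Be_mul_E2]
  · rw [← E2_mul_GAB_pow_comm, E2_mul_GAB_pow _ _ i.succ_ne_zero]
  · rw [E2_mul_Et_pow_comm, mul_assoc, E2_mul_E2]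

lemma path_mul_eq_zero_of_not_endsAtOne {x : DA F k s c} (hx : ε₂ * x = 0) {f : Family}
    (hf : ¬ f.endsAtOne) (i : ℕ) : path F k s c f i * x = 0 := by
  rw [← path_mul_E2 hf, mul_assoc, hx, mul_zero]

lemma path_mul_eq_zero_of_endsAtOne {x : DA F k s c} (hx : ε₁ * x = 0) {f : Family}
    (hf : f.endsAtOne) (i : ℕ) : path F k s c f i * x = 0 := by
  rw [← path_mul_E1 hf, mul_assoc, hx, mul_zero]

lemma psi_comm_of_path (hk : 0 < k) {x : DA F k s c}
    (h : ∀ f i, ψ (x * path F k s c f i) = ψ (path F k s c f i * x)) (y : DA F k s c) :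
    ψ (x * y) = ψ (y * x) := by
  have hy : y ∈ pathSpan F k s c 0 := span_path_eq_top (F := F) (s := s) (c := c) hk ▸ trivial
  induction hy using Submodule.span_induction with
  | mem y hy => obtain ⟨f, i, -, rfl⟩ := hy; exact h f i
  | zero => simp
  | add y z _ _ hy hz => rw [mul_add, add_mul, map_add, map_add, hy, hz]
  | smul r y _ hy => rw [mul_smul_comm, smul_mul_assoc, map_smul, map_smul, hy]

lemma psi_E1_comm (hk : 0 < k) (hs : 0 < s) (hψ : SoclePsi F k s c ψ) (y : DA F k s c) :
    ψ (ε₁ * y) = ψ (y * ε₁) := by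
  refine psi_comm_of_path hk (fun f i => ?_) y
  by_cases hf : f.startsAtOne <;> by_cases hf' : f.endsAtOne
  · rw [E1_mul_path hf, path_mul_E1 hf']
  · rw [E1_mul_path hf, path_mul_eq_zero_of_not_endsAtOne (E2_mul_E1 F k s c) hf', map_zero]
    refine psi_path_of_off_diagonal hk hs hψ ?_ i
    cases f <;> simp [Family.startsAtOne, Family.endsAtOne] at hf hf' ⊢
  · rw [mul_path_eq_zero_of_not_startsAtOne (E1_mul_E2 F k s c) hf, path_mul_E1 hf', map_zero]
    refine (psi_path_of_off_diagonal hk hs hψ ?_ i).symm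
    cases f <;> simp [Family.startsAtOne, Family.endsAtOne] at hf hf' ⊢
  · rw [mul_path_eq_zero_of_not_startsAtOne (E1_mul_E2 F k s c) hf,
      path_mul_eq_zero_of_not_endsAtOne (E2_mul_E1 F k s c) hf']

lemma psi_E2_comm (hk : 0 < k) (hs : 0 < s) (hψ : SoclePsi F k s c ψ) (y : DA F k s c) :
    ψ (ε₂ * y) = ψ (y * ε₂) := by
  rw [eq_sub_of_add_eq' (E1_add_E2 F k s c), sub_mul, mul_sub, map_sub, map_sub,
    psi_E1_comm hk hs hψ, one_mul, mul_one]

lemma psi_comm_of_orthogonal_left {e e' x p : DA F k s c} (he : ∀ y, ψ (e * y) = ψ (y * e))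
    (hee : e * e' = 0) (hx : x * e = x) (hp : e' * p = p) : ψ (x * p) = ψ (p * x) := by
  have h1 : x * p = 0 := by rw [← hx, ← hp, mul_assoc, ← mul_assoc e, hee, zero_mul, mul_zero]
  have h2 : ψ (p * x) = 0 := by
    rw [← hx, ← mul_assoc, ← he, ← hp, mul_assoc, ← mul_assoc, hee, zero_mul, map_zero]
  rw [h1, h2, map_zero]

lemma psi_comm_of_orthogonal_right {e e' x p : DA F k s c} (he : ∀ y, ψ (e * y) = ψ (y * e))
    (hee : e * e' = 0) (hp : p * e = p) (hx : e' * x = x) : ψ (x * p) = ψ (p * x) :=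
  (psi_comm_of_orthogonal_left he hee hp hx).symm

lemma path_x2_mul_Al (hs : 0 < s) {i : ℕ} (hi : i ≠ 0) : path F k s c .x2 i * 𝐚 = 0 := by
  rw [path, ← Al_mul_BGA_pow, mul_assoc, BGA_pow_mul_Al _ _ hs hi, mul_zero]
lemma path_x4_mul_Al (i : ℕ) : path F k s c .x4 i * 𝐚 = path F k s c .x3 (i + 1) := by
  simp only [path]
  rw [E1_mul_BGA_pow _ _ i.succ_ne_zero, pow_succ, BGA, mul_assoc]
lemma path_z1_mul_Be (i : ℕ) : path F k s c .z1 i * 𝐛 = 0 := by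
  rw [path, mul_assoc, Ga_mul_Be, mul_zero]
lemma path_z2_mul_Be (i : ℕ) : path F k s c .z2 i * 𝐛 = path F k s c .z3 i := by
  simp only [path]; rw [mul_assoc, pow_succ, GAB]
lemma path_y2_mul_Ga (i : ℕ) : path F k s c .y2 i * 𝐠 = path F k s c .x1 (i + 1) := by
  simp only [path]
  rw [E1_mul_ABG_pow _ _ i.succ_ne_zero, pow_succ, ABG, mul_assoc]

lemma psi_Al_comm (hk : 0 < k) (hs : 0 < s) (hψ : SoclePsi F k s c ψ) (y : DA F k s c) :
    ψ (𝐚 * y) = ψ (y * 𝐚) := by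
  refine psi_comm_of_path hk (fun f i => ?_) y
  by_cases hf : f.startsAtOne
  swap
  · exact psi_comm_of_orthogonal_left (psi_E1_comm hk hs hψ) (E1_mul_E2 F k s c)
      (Al_mul_E1 F k s c) (E2_mul_path hf i)
  by_cases hf' : f.endsAtOne
  swap
  · exact psi_comm_of_orthogonal_right (psi_E2_comm hk hs hψ) (E2_mul_E1 F k s c)
      (path_mul_E2 hf' i) (E1_mul_Al F k s c)
  cases f <;> simp only [Family.startsAtOne, Family.endsAtOne] at hf hf'
  · rcases eq_or_ne i 0 with rfl | hi
    · simp [path, E1_mul_Al, Al_mul_E1]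
    · rw [Al_mul_path_x1 hk hi, map_zero, path, E1_mul_ABG_pow _ _ hi]
      exact (psi_path_x2 hk hs hψ i).symm
  · rcases eq_or_ne i 0 with rfl | hi
    · simp [path]
    · rw [Al_mul_path_x2 hk hi, path_x2_mul_Al hs hi]
  · rcases eq_or_ne i 0 with rfl | hi
    · simp [path, E1_mul_Al, Al_mul_E1]
    · rw [Al_mul_path_x3, psi_path_x2 hk hs hψ, path, E1_mul_BGA_pow _ _ hi,
        BGA_pow_mul_Al _ _ hs hi, map_zero]
  · rw [Al_mul_path_x4, path_x4_mul_Al, psi_path_x1 hk hs hψ, psi_path_x3 hk hs hψ]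

lemma psi_Be_comm (hk : 0 < k) (hs : 0 < s) (hψ : SoclePsi F k s c ψ) (y : DA F k s c) :
    ψ (𝐛 * y) = ψ (y * 𝐛) := by
  refine psi_comm_of_path hk (fun f i => ?_) y
  by_cases hf : f.startsAtOne
  · exact psi_comm_of_orthogonal_left (psi_E2_comm hk hs hψ) (E2_mul_E1 F k s c)
      (Be_mul_E2 F k s c) (E1_mul_path hf i)
  by_cases hf' : f.endsAtOne
  swap
  · exact psi_comm_of_orthogonal_right (psi_E2_comm hk hs hψ) (E2_mul_E1 F k s c)
      (path_mul_E2 hf' i) (E1_mul_Be F k s c)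
  cases f <;> simp only [Family.startsAtOne, Family.endsAtOne, not_true_eq_false] at hf hf'
  · rw [Be_mul_path_z1, psi_path_x4 hk hs hψ, path_z1_mul_Be, map_zero]
  · rw [Be_mul_path_z2, psi_path_x3 hk hs hψ, path_z2_mul_Be, psi_path_z3 hk hs hψ]

lemma psi_Ga_comm (hk : 0 < k) (hs : 0 < s) (hψ : SoclePsi F k s c ψ) (y : DA F k s c) :
    ψ (𝐠 * y) = ψ (y * 𝐠) := by
  refine psi_comm_of_path hk (fun f i => ?_) y
  by_cases hf : f.startsAtOne
  swap
  · exact psi_comm_of_orthogonal_left (psi_E1_comm hk hs hψ) (E1_mul_E2 F k s c)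
      (Ga_mul_E1 F k s c) (E2_mul_path hf i)
  by_cases hf' : f.endsAtOne
  · exact psi_comm_of_orthogonal_right (psi_E1_comm hk hs hψ) (E1_mul_E2 F k s c)
      (path_mul_E1 hf' i) (E2_mul_Ga F k s c)
  cases f <;> simp only [Family.startsAtOne, Family.endsAtOne, not_true_eq_false] at hf hf'
  · rw [Ga_mul_path_y2, psi_path_z3 hk hs hψ, path_y2_mul_Ga, psi_path_x1 hk hs hψ]
  · rw [Ga_mul_path_y3, map_zero, path, mul_assoc]
    exact (psi_path_x4 hk hs hψ i).symm

lemma psi_Et_comm (hk : 0 < k) (hs : 0 < s) (hψ : SoclePsi F k s c ψ) (y : DA F k s c) :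
    ψ (𝐡 * y) = ψ (y * 𝐡) := by
  refine psi_comm_of_path hk (fun f i => ?_) y
  by_cases hf : f.startsAtOne
  · exact psi_comm_of_orthogonal_left (psi_E2_comm hk hs hψ) (E2_mul_E1 F k s c)
      (Et_mul_E2 F k s c) (E1_mul_path hf i)
  by_cases hf' : f.endsAtOne
  · exact psi_comm_of_orthogonal_right (psi_E1_comm hk hs hψ) (E1_mul_E2 F k s c)
      (path_mul_E1 hf' i) (E2_mul_Et F k s c)
  cases f <;> simp only [Family.startsAtOne, Family.endsAtOne, not_true_eq_false] at hf hf'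
  · rw [Et_mul_path_z3, path, pow_succ, mul_assoc, GAB_mul_Et, mul_zero]
  · rw [Et_mul_path_h]
    simp only [path]
    rw [mul_assoc, pow_succ]

/-- The form `ψ` is symmetric. -/
lemma psi_comm (hk : 0 < k) (hs : 0 < s) (hψ : SoclePsi F k s c ψ) (x y : DA F k s c) :
    ψ (x * y) = ψ (y * x) := by
  induction x using DA_induction generalizing y with
  | h1 => exact psi_E1_comm hk hs hψ y
  | h2 => exact psi_E2_comm hk hs hψ y
  | ha x hx =>
    rcases hx with rfl | rfl | rfl | rfl
    exacts [psi_Al_comm hk hs hψ y, psi_Be_comm hk hs hψ y, psi_Ga_comm hk hs hψ y,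
      psi_Et_comm hk hs hψ y]
  | hr r => rw [Algebra.commutes]
  | hadd x z hx hz => rw [add_mul, mul_add, map_add, map_add, hx, hz]
  | hmul x z hx hz => rw [mul_assoc, hx, mul_assoc, hz, mul_assoc]

/-- A subspace containing all commutators and the cyclic paths `α`, `(αβγ)ⁱ` and `ηʲ` is
everything. -/
lemma eq_top_of_commutator_mem (hk : 0 < k) (hs : 0 < s) {S : Submodule F (DA F k s c)}
    (hS : ∀ u v, u * v - v * u ∈ S) (ha : 𝐚 ∈ S) (hu : ∀ i < k, ε₁ * 𝐮 ^ i ∈ S)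
    (hh : ∀ j < s, ε₂ * 𝐡 ^ j ∈ S) (hw : 𝐡 ^ s ∈ S) : S = ⊤ := by
  have hcomm {u v : DA F k s c} (h : v * u ∈ S) : u * v ∈ S := by
    simpa using add_mem (hS u v) h
  have hz3 (i : ℕ) : path F k s c .z3 i ∈ S := by
    rcases lt_trichotomy (i + 1) k with h | h | h
    · rw [← Ga_mul_path_y2]
      refine hcomm ?_
      rw [path_y2_mul_Ga]
      exact hu _ h
    · rwa [path, h, ← Et_pow_eq_GAB_pow]
    · rw [path, GAB_pow_eq_zero _ _ hs h]
      exact zero_mem _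
  rw [eq_top_iff, ← span_path_eq_top hk, pathSpan, Submodule.span_le]
  rintro _ ⟨f, i, -, rfl⟩
  rw [SetLike.mem_coe]
  cases f
  · rcases Nat.eq_zero_or_eq_succ_pred i with h | h
    · rw [h]; exact hu 0 hk
    · rw [h, Nat.succ_eq_add_one, ← path_y2_mul_Ga]
      refine hcomm ?_
      rw [Ga_mul_path_y2]
      exact hz3 _
  · rcases eq_or_ne i 0 with rfl | hi
    · simpa [path] using ha
    · rw [path, ← Al_mul_BGA_pow]
      refine hcomm ?_
      rw [BGA_pow_mul_Al _ _ hs hi]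
      exact zero_mem _
  · rcases Nat.eq_zero_or_eq_succ_pred i with h | h
    · rw [h]; simpa [path] using hu 0 hk
    · rw [h, Nat.succ_eq_add_one, ← Be_mul_path_z2]
      refine hcomm ?_
      rw [path_z2_mul_Be]
      exact hz3 _
  · rw [← Be_mul_path_z1]
    refine hcomm ?_
    rw [path_z1_mul_Be]
    exact zero_mem _
  · rw [← E1_mul_path (by simp [Family.startsAtOne])]
    refine hcomm ?_
    rw [path_mul_eq_zero_of_not_endsAtOne (E2_mul_E1 F k s c) (by simp [Family.endsAtOne])]
    exact zero_mem _
  · rw [← E1_mul_path (by simp [Family.startsAtOne])]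
    refine hcomm ?_
    rw [path_mul_eq_zero_of_not_endsAtOne (E2_mul_E1 F k s c) (by simp [Family.endsAtOne])]
    exact zero_mem _
  · rw [← E2_mul_path (by simp [Family.startsAtOne])]
    refine hcomm ?_
    rw [path_mul_eq_zero_of_endsAtOne (E1_mul_E2 F k s c) (by simp [Family.endsAtOne])]
    exact zero_mem _
  · rw [← E2_mul_path (by simp [Family.startsAtOne])]
    refine hcomm ?_
    rw [path_mul_eq_zero_of_endsAtOne (E1_mul_E2 F k s c) (by simp [Family.endsAtOne])]
    exact zero_mem _
  · exact hz3 i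
  · rcases lt_trichotomy i s with h | rfl | h
    · exact hh i h
    · rwa [path, E2_mul_Et_pow _ _ hs.ne']
    · rw [path, Et_pow_eq_zero _ _ hk h, mul_zero]
      exact zero_mem _

end Symmetry

section CentralProducts

variable {F k s c}

lemma add_pow_of_mul_eq_zero {R : Type*} [Semiring R] {x y : R} (hxy : x * y = 0)
    (hyx : y * x = 0) {n : ℕ} (hn : n ≠ 0) : (x + y) ^ n = x ^ n + y ^ n := by
  obtain ⟨j, rfl⟩ := Nat.exists_eq_succ_of_ne_zero hn
  induction j with
  | zero => simp
  | succ j ih =>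
    rw [pow_succ, ih j.succ_ne_zero, add_mul, mul_add, mul_add, ← pow_succ, ← pow_succ,
      pow_succ x j, pow_succ y j, mul_assoc (x ^ j), mul_assoc (y ^ j), hxy, hyx, mul_zero,
      mul_zero, add_zero, zero_add]

lemma ABG_mul_GAB : 𝐮 * 𝐰 = 0 := by
  rw [← ABG_mul_E1, ← E2_mul_GAB, mul_assoc, ← mul_assoc ε₁, E1_mul_E2, zero_mul, mul_zero]
lemma GAB_mul_ABG : 𝐰 * 𝐮 = 0 := by
  rw [← GAB_mul_E2, ← E1_mul_ABG, mul_assoc, ← mul_assoc ε₂, E2_mul_E1, zero_mul, mul_zero]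
lemma BGA_mul_GAB : 𝐯 * 𝐰 = 0 := by
  rw [← BGA_mul_E1, ← E2_mul_GAB, mul_assoc, ← mul_assoc ε₁, E1_mul_E2, zero_mul, mul_zero]
lemma GAB_mul_BGA : 𝐰 * 𝐯 = 0 := by
  rw [← GAB_mul_E2, ← E1_mul_BGA, mul_assoc, ← mul_assoc ε₂, E2_mul_E1, zero_mul, mul_zero]

lemma omega_pow (hs : 0 < s) {n : ℕ} (hn : n ≠ 0) :
    (𝐮 + 𝐯 + 𝐰) ^ n = 𝐮 ^ n + 𝐯 ^ n + 𝐰 ^ n := by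
  have h1 : (𝐮 + 𝐯) * 𝐰 = 0 := by rw [add_mul, ABG_mul_GAB, BGA_mul_GAB, add_zero]
  have h2 : 𝐰 * (𝐮 + 𝐯) = 0 := by rw [mul_add, GAB_mul_ABG, GAB_mul_BGA, add_zero]
  rw [add_pow_of_mul_eq_zero h1 h2 hn,
    add_pow_of_mul_eq_zero (ABG_mul_BGA F c) (BGA_mul_ABG F c hs) hn]

lemma GAB_pow_mul_eq_zero {n : ℕ} (hn : n ≠ 0) {x : DA F k s c} (hx : ε₂ * x = 0) :
    𝐰 ^ n * x = 0 := by
  rw [← E2_mul_GAB_pow _ _ hn, E2_mul_GAB_pow_comm, mul_assoc, hx, mul_zero]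

lemma Et_pow_mul_eq_zero {n : ℕ} (hn : n ≠ 0) {x : DA F k s c} (hx : ε₂ * x = 0) :
    𝐡 ^ n * x = 0 := by
  rw [← E2_mul_Et_pow _ _ hn, E2_mul_Et_pow_comm, mul_assoc, hx, mul_zero]

lemma ABG_pow_mul_eq_zero {n : ℕ} (hn : n ≠ 0) {x : DA F k s c} (hx : ε₁ * x = 0) :
    𝐮 ^ n * x = 0 := by
  rw [← E1_mul_ABG_pow _ _ hn, E1_mul_ABG_pow_comm, mul_assoc, hx, mul_zero]

lemma BGA_pow_mul_eq_zero {n : ℕ} (hn : n ≠ 0) {x : DA F k s c} (hx : ε₁ * x = 0) :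
    𝐯 ^ n * x = 0 := by
  rw [← E1_mul_BGA_pow _ _ hn, E1_mul_BGA_pow_comm, mul_assoc, hx, mul_zero]

lemma E2_mul_ABG_pow {n : ℕ} (hn : n ≠ 0) : ε₂ * 𝐮 ^ n = 0 := by
  rw [← E1_mul_ABG_pow _ _ hn, ← mul_assoc, E2_mul_E1, zero_mul]

lemma E1_mul_Et_pow {n : ℕ} (hn : n ≠ 0) : ε₁ * 𝐡 ^ n = 0 := by
  rw [← E2_mul_Et_pow _ _ hn, ← mul_assoc, E1_mul_E2, zero_mul]

lemma BGA_pow_mul_ABG_pow (hs : 0 < s) {n m : ℕ} (hn : n ≠ 0) (hm : m ≠ 0) :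
    𝐯 ^ n * 𝐮 ^ m = 0 := by
  obtain ⟨j, rfl⟩ := Nat.exists_eq_succ_of_ne_zero hn
  rw [Nat.succ_eq_add_one, pow_succ, mul_assoc, BGA_mul_ABG_pow F c hs hm, mul_zero]

lemma GAB_mul_Et_pow {m : ℕ} (hm : m ≠ 0) : 𝐰 * 𝐡 ^ m = 0 := by
  rw [GAB, mul_assoc, Be_mul_Et_pow _ _ hm, mul_zero]

lemma GAB_pow_mul_Et_pow {n m : ℕ} (hn : n ≠ 0) (hm : m ≠ 0) : 𝐰 ^ n * 𝐡 ^ m = 0 := by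
  obtain ⟨j, rfl⟩ := Nat.exists_eq_succ_of_ne_zero hn
  rw [Nat.succ_eq_add_one, pow_succ, mul_assoc, GAB_mul_Et_pow hm, mul_zero]

lemma omega_pow_mul_ABG_pow (hs : 0 < s) {n m : ℕ} (hn : n ≠ 0) (hm : m ≠ 0) :
    (𝐮 + 𝐯 + 𝐰) ^ n * 𝐮 ^ m = 𝐮 ^ (n + m) := by
  rw [omega_pow hs hn, add_mul, add_mul, BGA_pow_mul_ABG_pow hs hn hm,
    GAB_pow_mul_eq_zero hn (E2_mul_ABG_pow hm), ← pow_add, add_zero, add_zero]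

lemma omega_pow_mul_E1 (hs : 0 < s) {n : ℕ} (hn : n ≠ 0) :
    (𝐮 + 𝐯 + 𝐰) ^ n * ε₁ = 𝐮 ^ n + 𝐯 ^ n := by
  rw [omega_pow hs hn, add_mul, add_mul, ← E1_mul_ABG_pow_comm, ← E1_mul_BGA_pow_comm,
    GAB_pow_mul_eq_zero hn (E2_mul_E1 F k s c), E1_mul_ABG_pow _ _ hn, E1_mul_BGA_pow _ _ hn,
    add_zero]

lemma omega_pow_mul_E2 (hs : 0 < s) {n : ℕ} (hn : n ≠ 0) :
    (𝐮 + 𝐯 + 𝐰) ^ n * ε₂ = 𝐰 ^ n := by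
  rw [omega_pow hs hn, add_mul, add_mul, ← E2_mul_GAB_pow_comm, E2_mul_GAB_pow _ _ hn,
    ABG_pow_mul_eq_zero hn (E1_mul_E2 F k s c), BGA_pow_mul_eq_zero hn (E1_mul_E2 F k s c),
    zero_add, zero_add]

lemma omega_pow_mul_Al (hs : 0 < s) {n : ℕ} (hn : n ≠ 0) :
    (𝐮 + 𝐯 + 𝐰) ^ n * 𝐚 = 𝐮 ^ n * 𝐚 := by
  rw [omega_pow hs hn, add_mul, add_mul, BGA_pow_mul_Al _ _ hs hn,
    GAB_pow_mul_eq_zero hn (E2_mul_Al F k s c), add_zero, add_zero]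

lemma omega_pow_mul_Et_pow (hs : 0 < s) {n m : ℕ} (hn : n ≠ 0) (hm : m ≠ 0) :
    (𝐮 + 𝐯 + 𝐰) ^ n * 𝐡 ^ m = 0 := by
  rw [omega_pow hs hn, add_mul, add_mul, ABG_pow_mul_eq_zero hn (E1_mul_Et_pow hm),
    BGA_pow_mul_eq_zero hn (E1_mul_Et_pow hm), GAB_pow_mul_Et_pow hn hm, add_zero, add_zero]

lemma sigma_mul_Al (hk : 0 < k) : 𝐯 ^ (k - 1) * (𝐛 * 𝐠) * 𝐚 = 𝐮 ^ k := by
  rw [ABG_pow_eq_BGA_pow, mul_assoc, ← BGA, ← pow_succ, Nat.sub_add_cancel hk]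

lemma sigma_mul_ABG_pow (hk : 0 < k) (hs : 0 < s) {m : ℕ} (hm : m ≠ 0) :
    𝐯 ^ (k - 1) * (𝐛 * 𝐠) * 𝐮 ^ m = 0 := by
  obtain ⟨j, rfl⟩ := Nat.exists_eq_succ_of_ne_zero hm
  rw [mul_assoc, BeGa_mul_ABG_pow, ← mul_assoc, ← pow_add,
    show k - 1 + (j + 1) = j + k by omega, pow_add, mul_assoc, BGA_pow_self_mul_BeGa _ _ hs,
    mul_zero]

lemma sigma_mul_E1 : 𝐯 ^ (k - 1) * (𝐛 * 𝐠) * ε₁ = 𝐯 ^ (k - 1) * (𝐛 * 𝐠) := by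
  simp only [mul_assoc, Ga_mul_E1]

lemma sigma_mul_eq_zero {x : DA F k s c} (hx : ε₁ * x = 0) :
    𝐯 ^ (k - 1) * (𝐛 * 𝐠) * x = 0 := by
  rw [← sigma_mul_E1, mul_assoc, hx, mul_zero]

lemma ABG_pow_self_mul_Al (hk : 0 < k) (hs : 0 < s) : 𝐮 ^ k * 𝐚 = 0 := by
  rw [ABG_pow_eq_BGA_pow, BGA_pow_mul_Al _ _ hs hk.ne']

lemma ABG_pow_self_mem_center (hk : 0 < k) (hs : 0 < s) :
    𝐮 ^ k ∈ Subalgebra.center F (DA F k s c) := by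
  rw [Subalgebra.mem_center_iff]
  intro x
  induction x using DA_induction with
  | h1 => exact E1_mul_ABG_pow_comm F c k
  | h2 => rw [E2_mul_ABG_pow hk.ne', ABG_pow_mul_eq_zero hk.ne' (E1_mul_E2 F k s c)]
  | ha x hx =>
    rcases hx with rfl | rfl | rfl | rfl
    · rw [Al_mul_ABG_pow _ _ hk hk.ne', ABG_pow_self_mul_Al hk hs]
    · rw [ABG_pow_mul_Be _ _ hk.ne', ← Be_mul_E2, mul_assoc, E2_mul_ABG_pow hk.ne', mul_zero]
    · rw [Ga_mul_ABG_pow_self _ _ hs, ABG_pow_mul_eq_zero hk.ne' (E1_mul_Ga F k s c)]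
    · rw [ABG_pow_mul_eq_zero hk.ne' (E1_mul_Et F k s c), ← Et_mul_E2, mul_assoc,
        E2_mul_ABG_pow hk.ne', mul_zero]
  | hr r => exact Algebra.commutes r _
  | hadd x y hx hy => rw [add_mul, mul_add, hx, hy]
  | hmul x y hx hy => rw [mul_assoc, hy, ← mul_assoc, hx, mul_assoc]

end CentralProducts

section Reynolds

variable {F k s c} {ψ : DA F k s c →ₗ[F] F}

lemma psi_mul_comm (hk : 0 < k) (hs : 0 < s) (hψ : SoclePsi F k s c ψ) {w : DA F k s c}
    (hw : w ∈ Subalgebra.center F (DA F k s c)) (x y : DA F k s c) :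
    ψ (w * (x * y)) = ψ (w * (y * x)) := by
  rw [Subalgebra.mem_center_iff] at hw
  rw [← mul_assoc, psi_comm hk hs hψ, ← mul_assoc, hw, mul_assoc]

lemma psi_mul_eq_zero_of_mem_Kspan (hk : 0 < k) (hs : 0 < s) (hψ : SoclePsi F k s c ψ)
    {w : DA F k s c} (hw : w ∈ Subalgebra.center F (DA F k s c)) {x : DA F k s c}
    (hx : x ∈ Kspan F (DA F k s c)) : ψ (w * x) = 0 := by
  induction hx using Submodule.span_induction with
  | mem x hx =>
    obtain ⟨u, v, rfl⟩ := hx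
    rw [mul_sub, map_sub, psi_mul_comm hk hs hψ hw, sub_self]
  | zero => simp
  | add x y _ _ hx hy => rw [mul_add, map_add, hx, hy, add_zero]
  | smul r x _ hx => rw [mul_smul_comm, map_smul, hx, smul_zero]

lemma mem_T1perp_of_sq [CharP F 2] (hk : 0 < k) (hs : 0 < s) (hψ : SoclePsi F k s c ψ)
    {w y : DA F k s c} (hw : w ∈ Subalgebra.center F (DA F k s c))
    (hy : y ∈ Subalgebra.center F (DA F k s c))
    (ha : ψ (w * 𝐚 ^ 2) = ψ (y * 𝐚) ^ 2)
    (hu : ∀ i < k, ψ (w * (ε₁ * 𝐮 ^ i) ^ 2) = ψ (y * (ε₁ * 𝐮 ^ i)) ^ 2)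
    (hh : ∀ j < s, ψ (w * (ε₂ * 𝐡 ^ j) ^ 2) = ψ (y * (ε₂ * 𝐡 ^ j)) ^ 2)
    (hw' : ψ (w * (𝐡 ^ s) ^ 2) = ψ (y * 𝐡 ^ s) ^ 2) : y ∈ T1perp F k s c ψ := by
  let S : Submodule F (DA F k s c) :=
    { carrier := {x | ψ (w * x ^ 2) = ψ (y * x) ^ 2}
      add_mem' := by
        intro x z hx hz
        simp only [Set.mem_ofPred_eq] at hx hz ⊢
        have h : (x + z) ^ 2 = x ^ 2 + z ^ 2 + (x * z + z * x) := by noncomm_ring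
        rw [h, mul_add, mul_add, mul_add w (x * z), map_add, map_add, map_add _ (w * (x * z)),
          psi_mul_comm hk hs hψ hw x z, CharTwo.add_self_eq_zero, hx, hz, mul_add, map_add,
          CharTwo.add_sq, add_zero]
      zero_mem' := by simp
      smul_mem' := by
        intro r x hx
        simp only [Set.mem_ofPred_eq] at hx ⊢
        rw [smul_pow, mul_smul_comm, mul_smul_comm, map_smul, map_smul, hx, smul_eq_mul,
          smul_eq_mul, mul_pow] }
  have hS : S = ⊤ := by
    refine eq_top_of_commutator_mem hk hs (fun u v => ?_) ha hu hh hw'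
    change ψ (w * (u * v - v * u) ^ 2) = ψ (y * (u * v - v * u)) ^ 2
    have h : (u * v - v * u) ^ 2 =
        u * (v * u * v) + v * u * v * u - (u * v * (v * u) + v * u * (u * v)) := by
      noncomm_ring
    rw [mul_sub, map_sub, psi_mul_comm hk hs hψ hy u v, sub_self, h, mul_sub, mul_add, mul_add,
      map_sub, map_add, map_add, psi_mul_comm hk hs hψ hw u, psi_mul_comm hk hs hψ hw (u * v),
      CharTwo.add_self_eq_zero, CharTwo.add_self_eq_zero]
    simp
  intro x hx
  have h : x ∈ S := hS ▸ Submodule.mem_top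
  change ψ (w * x ^ 2) = ψ (y * x) ^ 2 at h
  rw [psi_mul_eq_zero_of_mem_Kspan hk hs hψ hw hx] at h
  exact pow_eq_zero_iff two_ne_zero |>.mp h.symm

lemma mul_mem_T1set {z x : DA F k s c} (hz : z ∈ Subalgebra.center F (DA F k s c))
    (hx : x ∈ T1set F k s c) : z * x ∈ T1set F k s c := by
  have hcz := Subalgebra.mem_center_iff.mp hz
  have hK {y : DA F k s c} (hy : y ∈ Kspan F (DA F k s c)) : z * y ∈ Kspan F (DA F k s c) := by
    induction hy using Submodule.span_induction with
    | mem y hy =>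
      obtain ⟨u, v, rfl⟩ := hy
      refine Submodule.subset_span ⟨z * u, v, ?_⟩
      rw [mul_sub, ← mul_assoc v, hcz v]
      noncomm_ring
    | zero => simp
    | add x y _ _ hx hy => rw [mul_add]; exact add_mem hx hy
    | smul r x _ hx => rw [mul_smul_comm]; exact Submodule.smul_mem _ _ hx
  change (z * x) ^ 2 ∈ Kspan F (DA F k s c)
  rw [(Commute.mul_pow (show Commute z x from (hcz x).symm) 2), sq z, mul_assoc]
  exact hK (hK hx)

lemma mem_ReynoldsIdeal {z : Subalgebra.center F (DA F k s c)} :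
    z ∈ ReynoldsIdeal F k s c ψ ↔ (z : DA F k s c) ∈ T1perp F k s c ψ := by
  refine ⟨fun h => ?_, fun h => Ideal.subset_span h⟩
  induction h using Submodule.span_induction with
  | mem x hx => exact hx
  | zero => intro x _; simp
  | add x y _ _ hx hy =>
    intro u hu
    rw [Subalgebra.coe_add, add_mul, map_add, hx u hu, hy u hu, add_zero]
  | smul r x _ hx =>
    intro u hu
    rw [smul_eq_mul, mul_comm, Subalgebra.coe_mul, mul_assoc]
    exact hx _ (mul_mem_T1set r.2 hu)

lemma zq_eq_iff {x y : Subalgebra.center F (DA F k s c)} :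
    zq F k s c ψ x = zq F k s c ψ y ↔ (x - y : DA F k s c) ∈ T1perp F k s c ψ := by
  rw [← Subalgebra.coe_sub, ← mem_ReynoldsIdeal]
  exact Ideal.Quotient.eq

lemma zq_surjective : Function.Surjective (zq F k s c ψ) := Ideal.Quotient.mk_surjective

lemma zq_algebraMap (r : F) :
    zq F k s c ψ (algebraMap F _ r) = algebraMap F (Zbar F k s c ψ) r := rfl

/-- The functional on the center quotient given by pairing with an element of `T₁(A)`. -/
def pairing {x : DA F k s c} (hx : x ∈ T1set F k s c) : Zbar F k s c ψ →ₗ[F] F :=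
  Submodule.liftQ ((ReynoldsIdeal F k s c ψ).restrictScalars F)
    (ψ ∘ₗ LinearMap.mulRight F x ∘ₗ (Subalgebra.center F (DA F k s c)).val.toLinearMap)
    (fun _ hz => mem_ReynoldsIdeal.mp hz x hx)

lemma pairing_zq {x : DA F k s c} (hx : x ∈ T1set F k s c)
    (z : Subalgebra.center F (DA F k s c)) :
    pairing (ψ := ψ) hx (zq F k s c ψ z) = ψ (z * x) := rfl

lemma mem_T1set_of_sq_eq_zero {x : DA F k s c} (hx : x ^ 2 = 0) : x ∈ T1set F k s c := by
  rw [T1set, Set.mem_ofPred_eq, hx]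
  exact zero_mem _

end Reynolds

section Decomposition

variable {F k s c} {ψ : DA F k s c →ₗ[F] F}

lemma psi_ABG_pow (hk : 0 < k) (hs : 0 < s) (hψ : SoclePsi F k s c ψ) {i : ℕ} (hi : i ≠ 0) :
    ψ (𝐮 ^ i) = if i = k then 1 else 0 := by
  rw [← psi_path_x1 hk hs hψ i, path, E1_mul_ABG_pow _ _ hi]

lemma psi_BGA_pow (hk : 0 < k) (hs : 0 < s) (hψ : SoclePsi F k s c ψ) {i : ℕ} (hi : i ≠ 0) :
    ψ (𝐯 ^ i) = if i = k then 1 else 0 := by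
  rw [← psi_path_x3 hk hs hψ i, path, E1_mul_BGA_pow _ _ hi]

lemma psi_GAB_pow (hk : 0 < k) (hs : 0 < s) (hψ : SoclePsi F k s c ψ) {i : ℕ} (hi : i ≠ 0) :
    ψ (𝐰 ^ i) = if i = k then 1 else 0 := by
  obtain ⟨j, rfl⟩ := Nat.exists_eq_succ_of_ne_zero hi
  exact psi_path_z3 hk hs hψ j

lemma psi_Et_pow (hk : 0 < k) (hs : 0 < s) (hψ : SoclePsi F k s c ψ) {i : ℕ} (hi : i ≠ 0) :
    ψ (𝐡 ^ i) = if i = s then 1 else 0 := by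
  rw [← psi_path_h hk hs hψ i, path, E2_mul_Et_pow _ _ hi]

lemma psi_E1 (hk : 0 < k) (hs : 0 < s) (hψ : SoclePsi F k s c ψ) : ψ ε₁ = 0 := by
  simpa [path, hk.ne] using psi_path_x1 hk hs hψ 0

lemma psi_E2 (hk : 0 < k) (hs : 0 < s) (hψ : SoclePsi F k s c ψ) : ψ ε₂ = 0 := by
  simpa [path, hs.ne] using psi_path_h hk hs hψ 0

lemma psi_Al (hk : 0 < k) (hs : 0 < s) (hψ : SoclePsi F k s c ψ) : ψ 𝐚 = 0 := by
  simpa [path] using psi_path_x2 hk hs hψ 0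

lemma psi_ABG_pow_mul_Al (hk : 0 < k) (hs : 0 < s) (hψ : SoclePsi F k s c ψ) (i : ℕ) :
    ψ (𝐮 ^ i * 𝐚) = 0 := psi_path_x2 hk hs hψ i

lemma psi_sigma (hk : 0 < k) (hs : 0 < s) (hψ : SoclePsi F k s c ψ) :
    ψ (𝐯 ^ (k - 1) * (𝐛 * 𝐠)) = 0 := psi_path_x4 hk hs hψ (k - 1)

lemma ABG_pow_self_mem_T1perp [CharP F 2] (hk : 0 < k) (hs : 0 < s)
    (hψ : SoclePsi F k s c ψ) : 𝐮 ^ k ∈ T1perp F k s c ψ := by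
  have hc := ABG_pow_self_mem_center (F := F) (c := c) hk hs
  refine mem_T1perp_of_sq hk hs hψ hc hc ?_ (fun i hi => ?_) (fun j hj => ?_) ?_
  · rw [sq 𝐚, ← mul_assoc, ABG_pow_self_mul_Al hk hs]; simp
  · rcases eq_or_ne i 0 with rfl | h0
    · rw [pow_zero, mul_one, sq ε₁, E1_mul_E1, ← E1_mul_ABG_pow_comm, E1_mul_ABG_pow _ _ hk.ne',
        psi_ABG_pow_self hk hs hψ, one_pow]
    · rw [E1_mul_ABG_pow _ _ h0, ← pow_mul, ← pow_add, ← pow_add,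
        ABG_pow_eq_zero _ _ hk (by omega), ABG_pow_eq_zero _ _ hk (by omega)]
      simp
  · have h : 𝐮 ^ k * (ε₂ * 𝐡 ^ j) = 0 := by
      rw [← mul_assoc, ABG_pow_mul_eq_zero hk.ne' (E1_mul_E2 F k s c), zero_mul]
    rw [sq (ε₂ * 𝐡 ^ j), ← mul_assoc, h]; simp
  · have h : 𝐮 ^ k * 𝐡 ^ s = 0 := ABG_pow_mul_eq_zero hk.ne' (E1_mul_Et_pow hs.ne')
    rw [sq (𝐡 ^ s), ← mul_assoc, h]; simp

lemma mem_T1perp_of_psi_eq_zero (hk : 0 < k) (hs : 0 < s) (hψ : SoclePsi F k s c ψ)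
    {y : DA F k s c} (hy : y ∈ Subalgebra.center F (DA F k s c)) (ha : ψ (y * 𝐚) = 0)
    (hu : ∀ i < k, ψ (y * (ε₁ * 𝐮 ^ i)) = 0) (hh : ∀ j < s, ψ (y * (ε₂ * 𝐡 ^ j)) = 0)
    (hw : ψ (y * 𝐡 ^ s) = 0) : y ∈ T1perp F k s c ψ := by
  intro x _
  have hS : LinearMap.ker (ψ ∘ₗ LinearMap.mulLeft F y) = ⊤ := by
    refine eq_top_of_commutator_mem hk hs (fun u v => ?_) ha hu hh hw
    change ψ (y * (u * v - v * u)) = 0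
    rw [mul_sub, map_sub, psi_mul_comm hk hs hψ hy u v, sub_self]
  have h : x ∈ LinearMap.ker (ψ ∘ₗ LinearMap.mulLeft F y) := hS ▸ Submodule.mem_top
  exact h

lemma exists_sub_mem_T1perp [CharP F 2] (hk : 0 < k) (hs : 0 < s) (hψ : SoclePsi F k s c ψ)
    {zη zω zσ : Subalgebra.center F (DA F k s c)} (hη : (zη : DA F k s c) = 𝐡)
    (hω : (zω : DA F k s c) = 𝐮 + 𝐯 + 𝐰)
    (hσ : (zσ : DA F k s c) = 𝐯 ^ (k - 1) * (𝐛 * 𝐠)) (z : Subalgebra.center F (DA F k s c)) :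
    ∃ a : F, ∃ y ∈ Ideal.span {zη, zω, zσ},
      (z : DA F k s c) - (algebraMap F _ a + y) ∈ T1perp F k s c ψ := by
  let κ : Subalgebra.center F (DA F k s c) := ⟨𝐮 ^ k, ABG_pow_self_mem_center hk hs⟩
  let z₁ : Subalgebra.center F (DA F k s c) :=
    ∑ i ∈ Finset.range (k - 1), ψ (z * 𝐮 ^ (i + 1)) • zω ^ (k - (i + 1))
  let z₂ : Subalgebra.center F (DA F k s c) :=
    ∑ j ∈ Finset.range s, ψ ((z - z₁) * (ε₂ * 𝐡 ^ j)) • zη ^ (s - j)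
  let z₃ := ψ (z * 𝐚) • zσ
  let a := ψ (z * 𝐡 ^ s)
  let b := ψ ((z - z₁) * ε₁)
  have hz₁ (x : DA F k s c) : ψ (z₁ * x) = ∑ i ∈ Finset.range (k - 1),
      ψ (z * 𝐮 ^ (i + 1)) * ψ ((𝐮 + 𝐯 + 𝐰) ^ (k - (i + 1)) * x) := by
    simp only [z₁, AddSubmonoidClass.coe_finsetSum, Subalgebra.coe_smul, Subalgebra.coe_pow, hω,
      Finset.sum_mul, map_sum, smul_mul_assoc, map_smul, smul_eq_mul]
  have hz₂ (x : DA F k s c) : ψ (z₂ * x) = ∑ j ∈ Finset.range s,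
      ψ ((z - z₁) * (ε₂ * 𝐡 ^ j)) * ψ (𝐡 ^ (s - j) * x) := by
    simp only [z₂, AddSubmonoidClass.coe_finsetSum, Subalgebra.coe_smul, Subalgebra.coe_pow, hη,
      Finset.sum_mul, map_sum, smul_mul_assoc, map_smul, smul_eq_mul]
  have hmain : (z - (algebraMap F (Subalgebra.center F (DA F k s c)) a + (z₁ + z₂ + z₃)) - b • κ :
      Subalgebra.center F (DA F k s c)).1 ∈ T1perp F k s c ψ := by
    have hexp (x : DA F k s c) : ψ ((z - (algebraMap F (Subalgebra.center F (DA F k s c)) a +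
        (z₁ + z₂ + z₃)) - b • κ : Subalgebra.center F (DA F k s c)).1 * x) =
        ψ ((z - z₁) * x) - a * ψ x - ψ (z₂ * x) -
          ψ (z * 𝐚) * ψ (𝐯 ^ (k - 1) * (𝐛 * 𝐠) * x) - b * ψ (𝐮 ^ k * x) := by
      simp only [Subalgebra.coe_sub, Subalgebra.coe_add, Subalgebra.coe_smul, z₃, κ, hσ,
        OneMemClass.coe_one, Algebra.algebraMap_eq_smul_one, sub_mul, add_mul, map_sub,
        map_add, smul_mul_assoc, map_smul, one_mul, smul_eq_mul]
      ring
    refine mem_T1perp_of_psi_eq_zero hk hs hψ (SetLike.coe_mem _) ?_ (fun i hi => ?_)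
      (fun j hj => ?_) ?_
    · rw [hexp, sub_mul, map_sub, hz₁, hz₂, Finset.sum_eq_zero, Finset.sum_eq_zero,
        psi_Al hk hs hψ, sigma_mul_Al hk, psi_ABG_pow_self hk hs hψ, ABG_pow_self_mul_Al hk hs]
      · simp
      · intro j hj
        rw [Finset.mem_range] at hj
        rw [Et_pow_mul_eq_zero (by omega) (E2_mul_Al F k s c), map_zero, mul_zero]
      · intro i hi
        rw [Finset.mem_range] at hi
        rw [omega_pow_mul_Al hs (by omega), psi_ABG_pow_mul_Al hk hs hψ, mul_zero]
    · rcases eq_or_ne i 0 with rfl | h0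
      · rw [pow_zero, mul_one, hexp, hz₂, Finset.sum_eq_zero, psi_E1 hk hs hψ, sigma_mul_E1,
          psi_sigma hk hs hψ, ← E1_mul_ABG_pow_comm, E1_mul_ABG_pow _ _ hk.ne',
          psi_ABG_pow_self hk hs hψ]
        · simp [b]
        · intro j hj
          rw [Finset.mem_range] at hj
          rw [Et_pow_mul_eq_zero (by omega) (E2_mul_E1 F k s c), map_zero, mul_zero]
      · rw [E1_mul_ABG_pow _ _ h0, hexp, sub_mul, map_sub, hz₁, hz₂,
          Finset.sum_eq_single_of_mem (i - 1) (Finset.mem_range.mpr (by omega)),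
          Finset.sum_eq_zero, psi_ABG_pow hk hs hψ h0, if_neg hi.ne, sigma_mul_ABG_pow hk hs h0,
          ← pow_add, ABG_pow_eq_zero _ _ hk (show k < k + i by omega),
          omega_pow_mul_ABG_pow hs (by omega) h0, Nat.sub_add_cancel (by omega),
          Nat.sub_add_cancel hi.le, psi_ABG_pow_self hk hs hψ]
        · simp
        · intro j hj
          rw [Finset.mem_range] at hj
          rw [Et_pow_mul_eq_zero (by omega) (E2_mul_ABG_pow h0), map_zero, mul_zero]
        · intro j hj hji
          rw [Finset.mem_range] at hj
          rw [omega_pow_mul_ABG_pow hs (by omega) h0, psi_ABG_pow hk hs hψ (by omega),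
            if_neg (by omega), mul_zero]
    · have h1 : ε₁ * (ε₂ * 𝐡 ^ j) = 0 := by rw [← mul_assoc, E1_mul_E2, zero_mul]
      have h2 {m : ℕ} (hm : m ≠ 0) : 𝐡 ^ m * (ε₂ * 𝐡 ^ j) = 𝐡 ^ (m + j) := by
        rw [← mul_assoc, ← E2_mul_Et_pow_comm, E2_mul_Et_pow _ _ hm, pow_add]
      rw [hexp, sigma_mul_eq_zero h1, ABG_pow_mul_eq_zero hk.ne' h1, hz₂,
        Finset.sum_eq_single_of_mem j (Finset.mem_range.mpr hj), h2 (by omega),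
        Nat.sub_add_cancel hj.le, psi_Et_pow_self hk hs hψ, ← path, psi_path_h hk hs hψ,
        if_neg hj.ne]
      · simp
      · intro i hi hij
        rw [Finset.mem_range] at hi
        rw [h2 (by omega), psi_Et_pow hk hs hψ (by omega), if_neg (by omega), mul_zero]
    · have h1 : ε₁ * 𝐡 ^ s = 0 := E1_mul_Et_pow hs.ne'
      rw [hexp, sub_mul, map_sub, hz₁, hz₂, Finset.sum_eq_zero, Finset.sum_eq_zero,
        sigma_mul_eq_zero h1, ABG_pow_mul_eq_zero hk.ne' h1, psi_Et_pow_self hk hs hψ]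
      · simp [a]
      · intro j hj
        rw [Finset.mem_range] at hj
        rw [← pow_add, Et_pow_eq_zero _ _ hk (show s < s - j + s by omega), map_zero, mul_zero]
      · intro i hi
        rw [Finset.mem_range] at hi
        rw [omega_pow_mul_Et_pow hs (by omega) hs.ne', map_zero, mul_zero]
  refine ⟨a, z₁ + z₂ + z₃, add_mem (add_mem ?_ ?_) ?_, ?_⟩
  · refine sum_mem fun i hi => Submodule.smul_of_tower_mem _ _ (Ideal.pow_mem_of_mem _ ?_ _ ?_)
    · exact Ideal.subset_span (by simp)
    · rw [Finset.mem_range] at hi; omega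
  · refine sum_mem fun j hj => Submodule.smul_of_tower_mem _ _ (Ideal.pow_mem_of_mem _ ?_ _ ?_)
    · exact Ideal.subset_span (by simp)
    · rw [Finset.mem_range] at hj; omega
  · exact Submodule.smul_of_tower_mem _ _ (Ideal.subset_span (by simp))
  · have hκ : κ ∈ ReynoldsIdeal F k s c ψ :=
      mem_ReynoldsIdeal.mpr (ABG_pow_self_mem_T1perp hk hs hψ)
    have h := add_mem (mem_ReynoldsIdeal.mpr hmain) (Submodule.smul_of_tower_mem _ b hκ)
    rw [sub_add_cancel] at h
    exact mem_ReynoldsIdeal.mp h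

end Decomposition

section Relation

variable {F k s c} {ψ : DA F k s c →ₗ[F] F}

lemma sigma_sub_mem_T1perp [CharP F 2] (hk : 0 < k) (hs : 0 < s) (hψ : SoclePsi F k s c ψ)
    (hc : c = 1) {m n : ℕ} (hm : m + m = k) (hn : n + n = s)
    (ht : 𝐯 ^ (k - 1) * (𝐛 * 𝐠) - (𝐡 ^ n + (𝐮 + 𝐯 + 𝐰) ^ m) ∈ Subalgebra.center F (DA F k s c)) :
    𝐯 ^ (k - 1) * (𝐛 * 𝐠) - (𝐡 ^ n + (𝐮 + 𝐯 + 𝐰) ^ m) ∈ T1perp F k s c ψ := by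
  have hm0 : m ≠ 0 := by omega
  have hn0 : n ≠ 0 := by omega
  have hmk : m ≠ k := by omega
  have hns : n ≠ s := by omega
  refine mem_T1perp_of_sq hk hs hψ (one_mem _) ht ?_ (fun i hi => ?_) (fun j hj => ?_) ?_
  · rw [one_mul, sq 𝐚, Al_mul_Al, map_smul, psi_ABG_pow_self hk hs hψ, sub_mul, add_mul,
      sigma_mul_Al hk, Et_pow_mul_eq_zero hn0 (E2_mul_Al F k s c), omega_pow_mul_Al hs hm0,
      map_sub, map_add, psi_ABG_pow_mul_Al hk hs hψ, psi_ABG_pow_self hk hs hψ]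
    simp [hc]
  · rcases eq_or_ne i 0 with rfl | h0
    · rw [pow_zero, mul_one, one_mul, sq ε₁, E1_mul_E1, psi_E1 hk hs hψ, sub_mul, add_mul,
        sigma_mul_E1, Et_pow_mul_eq_zero hn0 (E2_mul_E1 F k s c), omega_pow_mul_E1 hs hm0,
        map_sub, map_add, map_add, psi_sigma hk hs hψ, psi_ABG_pow hk hs hψ hm0,
        psi_BGA_pow hk hs hψ hm0, if_neg hmk]
      simp
    · rw [one_mul, E1_mul_ABG_pow _ _ h0, ← pow_mul, psi_ABG_pow hk hs hψ (by omega), sub_mul,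
        add_mul, sigma_mul_ABG_pow hk hs h0, Et_pow_mul_eq_zero hn0 (E2_mul_ABG_pow h0),
        omega_pow_mul_ABG_pow hs hm0 h0, zero_add, zero_sub, map_neg,
        psi_ABG_pow hk hs hψ (by omega), neg_sq]
      by_cases h : i * 2 = k
      · rw [if_pos h, if_pos (by omega), one_pow]
      · rw [if_neg h, if_neg (by omega), zero_pow two_ne_zero]
  · rcases eq_or_ne j 0 with rfl | h0
    · rw [pow_zero, mul_one, one_mul, sq ε₂, E2_mul_E2, psi_E2 hk hs hψ, sub_mul, add_mul,
        sigma_mul_eq_zero (E1_mul_E2 F k s c), ← E2_mul_Et_pow_comm, E2_mul_Et_pow _ _ hn0,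
        omega_pow_mul_E2 hs hm0, map_sub, map_add, psi_Et_pow hk hs hψ hn0,
        psi_GAB_pow hk hs hψ hm0, if_neg hmk, if_neg hns]
      simp
    · rw [one_mul, E2_mul_Et_pow _ _ h0, ← pow_mul, psi_Et_pow hk hs hψ (by omega), sub_mul,
        add_mul, sigma_mul_eq_zero (E1_mul_Et_pow h0), omega_pow_mul_Et_pow hs hm0 h0, ← pow_add,
        add_zero, zero_sub, map_neg, psi_Et_pow hk hs hψ (by omega), neg_sq]
      by_cases h : j * 2 = s
      · rw [if_pos h, if_pos (by omega), one_pow]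
      · rw [if_neg h, if_neg (by omega), zero_pow two_ne_zero]
  · rw [one_mul, ← pow_mul, Et_pow_eq_zero _ _ hk (show s < s * 2 by omega), sub_mul, add_mul,
      sigma_mul_eq_zero (E1_mul_Et_pow hs.ne'), omega_pow_mul_Et_pow hs hm0 hs.ne', ← pow_add,
      Et_pow_eq_zero _ _ hk (show s < n + s by omega)]
    simp

end Relation

section LocalAlgebra

variable {F} {R : Type} [CommRing R] [Algebra F R] {ι : Type}

lemma jacobson_bot_eq_span [Nontrivial R] {g : ι → R} (hg : ∀ i, IsNilpotent (g i))
    (hspan : ∀ x : R, ∃ a : F, x - algebraMap F R a ∈ Ideal.span (Set.range g)) :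
    Ideal.jacobson (⊥ : Ideal R) = Ideal.span (Set.range g) := by
  have hle : Ideal.span (Set.range g) ≤ Ideal.jacobson (⊥ : Ideal R) := by
    rw [Ideal.span_le]
    rintro _ ⟨i, rfl⟩
    exact Ideal.radical_le_jacobson (mem_nilradical.mpr (hg i))
  refine le_antisymm (fun x hx => ?_) hle
  obtain ⟨a, ha⟩ := hspan x
  have haJ : algebraMap F R a ∈ Ideal.jacobson (⊥ : Ideal R) := by
    simpa using sub_mem hx (hle ha)
  rcases eq_or_ne a 0 with rfl | h0
  · simpa using ha
  · have htop := Ideal.eq_top_of_isUnit_mem _ haJ ((IsUnit.mk0 a h0).map (algebraMap F R))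
    exact absurd (Ideal.jacobson_eq_top_iff.mp htop) bot_ne_top

lemma restrictScalars_span_eq_sup [Fintype ι] {g : ι → R}
    (hspan : ∀ x : R, ∃ a : F, x - algebraMap F R a ∈ Ideal.span (Set.range g)) :
    (Ideal.span (Set.range g)).restrictScalars F = Submodule.span F (Set.range g) ⊔
      (Ideal.span (Set.range g) * Ideal.span (Set.range g)).restrictScalars F := by
  refine le_antisymm (fun x hx => ?_) (sup_le (Submodule.span_le.mpr Submodule.subset_span)
    (fun x hx => Ideal.mul_le_left hx))
  obtain ⟨r, rfl⟩ := (Submodule.mem_span_range_iff_exists_fun R).mp hx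
  refine sum_mem fun j _ => ?_
  obtain ⟨a, ha⟩ := hspan (r j)
  rw [← sub_add_cancel (r j) (algebraMap F R a), add_smul, algebraMap_smul]
  exact add_mem (Submodule.mem_sup_right (Ideal.mul_mem_mul ha
    (Ideal.subset_span (Set.mem_range_self j))))
    (Submodule.mem_sup_left (Submodule.smul_mem _ _ (Submodule.subset_span
      (Set.mem_range_self j))))

lemma apply_eq_zero_of_mem_span_mul_span {g : ι → R} {φ : R →ₗ[F] F}
    (hφ : ∀ j l r, φ (r * (g j * g l)) = 0) {x : R}
    (hx : x ∈ Ideal.span (Set.range g) * Ideal.span (Set.range g)) : φ x = 0 := by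
  rw [Ideal.span_mul_span'] at hx
  suffices h : ∀ r, φ (r * x) = 0 by simpa using h 1
  induction hx using Submodule.span_induction with
  | mem x hx =>
    obtain ⟨_, ⟨j, rfl⟩, _, ⟨l, rfl⟩, rfl⟩ := hx
    exact hφ j l
  | zero => simp
  | add x y _ _ hx hy => intro r; rw [mul_add, map_add, hx, hy, add_zero]
  | smul r x _ hx => intro r'; rw [smul_eq_mul, ← mul_assoc]; exact hx _

lemma radQuotDim_jacobson_bot [Nontrivial R] [Fintype ι] [DecidableEq ι] {g : ι → R}
    (hg : ∀ i, IsNilpotent (g i))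
    (hspan : ∀ x : R, ∃ a : F, x - algebraMap F R a ∈ Ideal.span (Set.range g))
    {φ : ι → R →ₗ[F] F} (hφ : ∀ i j, φ i (g j) = if i = j then 1 else 0)
    (hφ' : ∀ i j l r, φ i (r * (g j * g l)) = 0) :
    radQuotDim F (Ideal.jacobson (⊥ : Ideal R)) = Fintype.card ι := by
  rw [jacobson_bot_eq_span hg hspan]
  set I := Ideal.span (Set.range g) with hI
  let Φ : I.restrictScalars F →ₗ[F] (ι → F) :=
    LinearMap.pi φ ∘ₗ (I.restrictScalars F).subtype
  have hΦ (a : ι → F) : LinearMap.pi φ (∑ j, a j • g j) = a := by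
    ext i
    simp [hφ]
  have hmem (a : ι → F) : ∑ j, a j • g j ∈ I.restrictScalars F :=
    sum_mem fun j _ => Submodule.smul_mem _ _ (Ideal.subset_span (Set.mem_range_self j))
  have hsurj : Function.Surjective Φ := fun a => ⟨⟨_, hmem a⟩, hΦ a⟩
  have hker : Submodule.comap (I.restrictScalars F).subtype ((I * I).restrictScalars F) =
      LinearMap.ker Φ := by
    ext ⟨x, hx⟩
    refine ⟨fun h => funext fun i => apply_eq_zero_of_mem_span_mul_span (hφ' i) h, fun h => ?_⟩
    have hx' := hx
    rw [restrictScalars_span_eq_sup hspan, Submodule.mem_sup] at hx'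
    obtain ⟨y, hy, z, hz, rfl⟩ := hx'
    obtain ⟨a, rfl⟩ := (Submodule.mem_span_range_iff_exists_fun F).mp hy
    have h' : LinearMap.pi φ (∑ j, a j • g j + z) = 0 := h
    have hz' : LinearMap.pi φ z = 0 :=
      funext fun i => apply_eq_zero_of_mem_span_mul_span (hφ' i) hz
    rw [map_add, hΦ, hz', add_zero] at h'
    change ∑ j, a j • g j + z ∈ I * I
    rw [h']
    simp only [Pi.zero_apply, zero_smul, Finset.sum_const_zero, zero_add]
    exact hz
  rw [radQuotDim, (Submodule.quotEquivOfEq _ _ hker).finrank_eq,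
    (LinearMap.quotKerEquivOfSurjective Φ hsurj).finrank_eq, Module.finrank_fintype_fun_eq_card]

end LocalAlgebra

section DualFrame

/-- A family of nilpotent elements generating a local algebra `R` with residue field `F`, together
with functionals dual to it which annihilate the square of the radical. -/
structure IsDualFrame {R ι : Type} [CommRing R] [Algebra F R] [DecidableEq ι] (g : ι → R)
    (φ : ι → R →ₗ[F] F) : Prop where
  isNilpotent : ∀ i, IsNilpotent (g i)
  sub_mem_span : ∀ x : R, ∃ a : F, x - algebraMap F R a ∈ Ideal.span (Set.range g)
  apply : ∀ i j, φ i (g j) = if i = j then 1 else 0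
  apply_mul : ∀ i j l r, φ i (r * (g j * g l)) = 0

variable {F} {R R' ι : Type} [CommRing R] [Algebra F R] [CommRing R'] [Algebra F R']
  [DecidableEq ι] {g : ι → R} {φ : ι → R →ₗ[F] F}

lemma IsDualFrame.nontrivial [Nonempty ι] (h : IsDualFrame F g φ) : Nontrivial R := by
  obtain ⟨i⟩ := ‹Nonempty ι›
  refine nontrivial_of_ne (g i) 0 fun h0 => ?_
  simpa [h0] using h.apply i i

lemma IsDualFrame.comp_equiv (h : IsDualFrame F g φ) (e : R' ≃ₐ[F] R) :
    IsDualFrame F (fun i => e.symm (g i)) (fun i => φ i ∘ₗ e.toLinearMap) where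
  isNilpotent i := (h.isNilpotent i).map e.symm
  sub_mem_span x := by
    obtain ⟨a, ha⟩ := h.sub_mem_span (e x)
    refine ⟨a, ?_⟩
    have h' := Ideal.mem_map_of_mem e.symm ha
    rw [Ideal.map_span, ← Set.range_comp] at h'
    simpa [Function.comp_def] using h'
  apply i j := by simp [h.apply]
  apply_mul i j l r := by simp [h.apply_mul]

lemma IsDualFrame.restrictScalars_jacobson_bot [Fintype ι] [Nonempty ι] (h : IsDualFrame F g φ) :
    (Ideal.jacobson (⊥ : Ideal R)).restrictScalars F = Submodule.span F (Set.range g) ⊔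
      (Ideal.jacobson (⊥ : Ideal R) * Ideal.jacobson (⊥ : Ideal R)).restrictScalars F := by
  have := h.nontrivial
  rw [jacobson_bot_eq_span h.isNilpotent h.sub_mem_span]
  exact restrictScalars_span_eq_sup h.sub_mem_span

lemma IsDualFrame.radQuotDim_eq_card [Fintype ι] [Nonempty ι] (h : IsDualFrame F g φ) :
    radQuotDim F (Ideal.jacobson (⊥ : Ideal R)) = Fintype.card ι := by
  have := h.nontrivial
  exact radQuotDim_jacobson_bot h.isNilpotent h.sub_mem_span h.apply h.apply_mul

end DualFrame

section CenterQuotient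

variable {F k s c} {ψ : DA F k s c →ₗ[F] F} {zη zω zσ : Subalgebra.center F (DA F k s c)}

lemma isNilpotent_zq_eta (hk : 0 < k) (hη : (zη : DA F k s c) = 𝐡) :
    IsNilpotent (zq F k s c ψ zη) := by
  refine IsNilpotent.map ⟨s + 1, Subtype.ext ?_⟩ _
  rw [Subalgebra.coe_pow, hη, Et_pow_succ_self _ _ hk]
  rfl

lemma isNilpotent_zq_omega (hk : 0 < k) (hs : 0 < s) (hω : (zω : DA F k s c) = 𝐮 + 𝐯 + 𝐰) :
    IsNilpotent (zq F k s c ψ zω) := by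
  refine IsNilpotent.map ⟨k + 1, Subtype.ext ?_⟩ _
  rw [Subalgebra.coe_pow, hω, omega_pow hs k.succ_ne_zero, ABG_pow_succ_self _ _ hk,
    BGA_pow_succ_self _ _ hk hs, GAB_pow_succ_self _ _ hs]
  simp

lemma isNilpotent_zq_sigma (hk : 1 < k) (hσ : (zσ : DA F k s c) = 𝐯 ^ (k - 1) * (𝐛 * 𝐠)) :
    IsNilpotent (zq F k s c ψ zσ) := by
  refine IsNilpotent.map ⟨2, Subtype.ext ?_⟩ _
  rw [Subalgebra.coe_pow, hσ, sq, mul_assoc, mul_assoc 𝐛, ← mul_assoc 𝐠,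
    Ga_mul_BGA_pow _ _ (by omega)]
  simp

lemma exists_sub_mem_span_zq [CharP F 2] (hk : 0 < k) (hs : 0 < s) (hψ : SoclePsi F k s c ψ)
    (hη : (zη : DA F k s c) = 𝐡) (hω : (zω : DA F k s c) = 𝐮 + 𝐯 + 𝐰)
    (hσ : (zσ : DA F k s c) = 𝐯 ^ (k - 1) * (𝐛 * 𝐠)) (x : Zbar F k s c ψ) :
    ∃ a : F, x - algebraMap F _ a ∈
      Ideal.span {zq F k s c ψ zη, zq F k s c ψ zω, zq F k s c ψ zσ} := by
  obtain ⟨z, rfl⟩ := zq_surjective x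
  obtain ⟨a, y, hy, h⟩ := exists_sub_mem_T1perp hk hs hψ hη hω hσ z
  refine ⟨a, ?_⟩
  have hz : zq F k s c ψ z = zq F k s c ψ (algebraMap F _ a + y) := zq_eq_iff.mpr h
  rw [hz, map_add, zq_algebraMap, add_sub_cancel_left]
  have hy' := Ideal.mem_map_of_mem (zq F k s c ψ) hy
  rw [Ideal.map_span] at hy'
  simpa [Set.image_insert_eq] using hy'

lemma Et_pow_mem_T1set (hk : 0 < k) (hs : 2 < s) : 𝐡 ^ (s - 1) ∈ T1set F k s c :=
  mem_T1set_of_sq_eq_zero (by rw [← pow_mul, Et_pow_eq_zero _ _ hk (by omega)])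

lemma ABG_pow_mem_T1set (hk : 2 < k) : 𝐮 ^ (k - 1) ∈ T1set F k s c :=
  mem_T1set_of_sq_eq_zero (by rw [← pow_mul, ABG_pow_eq_zero _ _ (by omega) (by omega)])

lemma Al_mem_T1set (hc : c = 0) : 𝐚 ∈ T1set F k s c :=
  mem_T1set_of_sq_eq_zero (by rw [sq, Al_mul_Al, hc, zero_smul])

lemma mul_mul_Et_pow (hk : 1 < k) (hs : 1 < s) (hη : (zη : DA F k s c) = 𝐡)
    (hω : (zω : DA F k s c) = 𝐮 + 𝐯 + 𝐰) (hσ : (zσ : DA F k s c) = 𝐯 ^ (k - 1) * (𝐛 * 𝐠))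
    (j l : Fin 3) :
    ((![zη, zω, zσ] j * ![zη, zω, zσ] l : Subalgebra.center F (DA F k s c)) : DA F k s c) *
      𝐡 ^ (s - 1) = 0 := by
  have h1 (n : ℕ) : 𝐡 * 𝐡 ^ n = 𝐡 ^ (n + 1) := (pow_succ' _ _).symm
  have h2 {n : ℕ} (hn : n ≠ 0) : (𝐮 + 𝐯 + 𝐰) * 𝐡 ^ n = 0 := by
    simpa using omega_pow_mul_Et_pow (F := F) (c := c) (by omega) one_ne_zero hn
  have h3 {n : ℕ} (hn : n ≠ 0) : 𝐯 ^ (k - 1) * (𝐛 * 𝐠) * 𝐡 ^ n = 0 :=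
    sigma_mul_eq_zero (E1_mul_Et_pow hn)
  have hs' : s - 1 ≠ 0 := by omega
  rw [Subalgebra.coe_mul, mul_assoc]
  fin_cases j <;> fin_cases l <;>
    simp [hη, hω, hσ, h1, h2 hs', h3 hs', h2 (Nat.succ_ne_zero _), h3 (Nat.succ_ne_zero _),
      Et_pow_eq_zero F c (show 0 < k by omega) (show s < s - 1 + 1 + 1 by omega)]

lemma mul_mul_ABG_pow (hk : 1 < k) (hs : 1 < s) (hη : (zη : DA F k s c) = 𝐡)
    (hω : (zω : DA F k s c) = 𝐮 + 𝐯 + 𝐰) (hσ : (zσ : DA F k s c) = 𝐯 ^ (k - 1) * (𝐛 * 𝐠))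
    (j l : Fin 3) :
    ((![zη, zω, zσ] j * ![zη, zω, zσ] l : Subalgebra.center F (DA F k s c)) : DA F k s c) *
      𝐮 ^ (k - 1) = 0 := by
  have h1 {n : ℕ} (hn : n ≠ 0) : 𝐡 * 𝐮 ^ n = 0 := by
    simpa using Et_pow_mul_eq_zero (F := F) (c := c) one_ne_zero (E2_mul_ABG_pow hn)
  have h2 {n : ℕ} (hn : n ≠ 0) : (𝐮 + 𝐯 + 𝐰) * 𝐮 ^ n = 𝐮 ^ (1 + n) := by
    simpa using omega_pow_mul_ABG_pow (F := F) (c := c) (by omega) one_ne_zero hn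
  have h3 {n : ℕ} (hn : n ≠ 0) : 𝐯 ^ (k - 1) * (𝐛 * 𝐠) * 𝐮 ^ n = 0 :=
    sigma_mul_ABG_pow (by omega) (by omega) hn
  have hk' : k - 1 ≠ 0 := by omega
  have hk'' : 1 + (k - 1) ≠ 0 := by omega
  rw [Subalgebra.coe_mul, mul_assoc]
  fin_cases j <;> fin_cases l <;>
    simp [hη, hω, hσ, h1 hk', h2 hk', h3 hk', h1 hk'', h2 hk'', h3 hk'',
      ABG_pow_eq_zero F c (show 0 < k by omega) (show k < 1 + (1 + (k - 1)) by omega)]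

lemma psi_mul_mul_Al (hk : 1 < k) (hs : 1 < s) (hψ : SoclePsi F k s c ψ)
    (hη : (zη : DA F k s c) = 𝐡)
    (hω : (zω : DA F k s c) = 𝐮 + 𝐯 + 𝐰) (hσ : (zσ : DA F k s c) = 𝐯 ^ (k - 1) * (𝐛 * 𝐠))
    (j l : Fin 3) (z : Subalgebra.center F (DA F k s c)) :
    ψ (z * (((![zη, zω, zσ] j * ![zη, zω, zσ] l : Subalgebra.center F (DA F k s c)) :
      DA F k s c) * 𝐚)) = 0 := by
  have hk0 : 0 < k := by omega
  have hs0 : 0 < s := by omega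
  have h1 : 𝐡 * 𝐚 = 0 := by
    simpa using Et_pow_mul_eq_zero (F := F) (c := c) one_ne_zero (E2_mul_Al F k s c)
  have h1' {n : ℕ} (hn : n ≠ 0) : 𝐡 * 𝐮 ^ n = 0 := by
    simpa using Et_pow_mul_eq_zero (F := F) (c := c) one_ne_zero (E2_mul_ABG_pow hn)
  have h2 : (𝐮 + 𝐯 + 𝐰) * 𝐚 = 𝐮 * 𝐚 := by
    simpa using omega_pow_mul_Al (F := F) (c := c) hs0 one_ne_zero
  have h2' {n : ℕ} (hn : n ≠ 0) : (𝐮 + 𝐯 + 𝐰) * 𝐮 ^ n = 𝐮 ^ (1 + n) := by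
    simpa using omega_pow_mul_ABG_pow (F := F) (c := c) hs0 one_ne_zero hn
  have h3 : 𝐯 ^ (k - 1) * (𝐛 * 𝐠) * 𝐮 ^ k = 0 := sigma_mul_ABG_pow hk0 hs0 hk0.ne'
  have hωω : ψ (z * ((𝐮 + 𝐯 + 𝐰) * ((𝐮 + 𝐯 + 𝐰) * 𝐚))) = 0 := by
    rw [← mul_assoc (𝐮 + 𝐯 + 𝐰), ← sq, omega_pow_mul_Al hs0 two_ne_zero, ← Al_mul_BGA_pow,
      psi_mul_comm hk0 hs0 hψ z.2, BGA_pow_mul_Al _ _ hs0 two_ne_zero, mul_zero, map_zero]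
  have hcomm (x y : Subalgebra.center F (DA F k s c)) :
      (x * y : DA F k s c) * 𝐚 = y * (x * 𝐚) := by
    rw [← Subalgebra.coe_mul, mul_comm, Subalgebra.coe_mul, mul_assoc]
  have hz (x y : Subalgebra.center F (DA F k s c)) (h : (y * (x * 𝐚) : DA F k s c) = 0) :
    ψ (z * ((x * y : DA F k s c) * 𝐚)) = 0 ∧ ψ (z * ((y * x : DA F k s c) * 𝐚)) = 0 := by
    rw [hcomm x y, mul_assoc (y : DA F k s c), h, mul_zero, map_zero]
    exact ⟨rfl, rfl⟩
  have k1 (y : Subalgebra.center F (DA F k s c)) := hz zη y (by rw [hη, h1, mul_zero])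
  have k2 := hz zσ zω (by
    rw [hσ, hω, sigma_mul_Al hk0, h2' hk0.ne', ABG_pow_eq_zero _ _ hk0 (by omega)])
  have k3 := hz zσ zσ (by rw [hσ, sigma_mul_Al hk0, h3])
  have k4 : ψ (z * ((zω * zω : DA F k s c) * 𝐚)) = 0 := by rw [mul_assoc, hω, hωω]
  rw [Subalgebra.coe_mul]
  fin_cases j <;> fin_cases l
  exacts [(k1 zη).1, (k1 zω).1, (k1 zσ).1, (k1 zω).2, k4, k2.2, (k1 zσ).2, k2.1, k3.1]

end CenterQuotient

section Frames

variable {F k s c} {ψ : DA F k s c →ₗ[F] F} {zη zω zσ : Subalgebra.center F (DA F k s c)}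

lemma psi_mul_Et_pow (hk : 0 < k) (hs : 1 < s) (hψ : SoclePsi F k s c ψ)
    (hη : (zη : DA F k s c) = 𝐡) (hω : (zω : DA F k s c) = 𝐮 + 𝐯 + 𝐰)
    (hσ : (zσ : DA F k s c) = 𝐯 ^ (k - 1) * (𝐛 * 𝐠)) (j : Fin 3) :
    ψ (![zη, zω, zσ] j * 𝐡 ^ (s - 1)) = if 0 = j then 1 else 0 := by
  have hs' : s - 1 ≠ 0 := by omega
  have h1 : ψ (zη * 𝐡 ^ (s - 1)) = 1 := by
    rw [hη, ← pow_succ', Nat.sub_add_cancel hs.le, psi_Et_pow_self hk (by omega) hψ]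
  have h2 : ψ (zω * 𝐡 ^ (s - 1)) = 0 := by
    rw [hω, ← pow_one (𝐮 + 𝐯 + 𝐰), omega_pow_mul_Et_pow (by omega) one_ne_zero hs', map_zero]
  have h3 : ψ (zσ * 𝐡 ^ (s - 1)) = 0 := by
    rw [hσ, sigma_mul_eq_zero (E1_mul_Et_pow hs'), map_zero]
  fin_cases j
  exacts [h1, h2, h3]

lemma psi_mul_ABG_pow (hk : 1 < k) (hs : 0 < s) (hψ : SoclePsi F k s c ψ)
    (hη : (zη : DA F k s c) = 𝐡) (hω : (zω : DA F k s c) = 𝐮 + 𝐯 + 𝐰)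
    (hσ : (zσ : DA F k s c) = 𝐯 ^ (k - 1) * (𝐛 * 𝐠)) (j : Fin 3) :
    ψ (![zη, zω, zσ] j * 𝐮 ^ (k - 1)) = if 1 = j then 1 else 0 := by
  have hk' : k - 1 ≠ 0 := by omega
  have h1 : ψ (zη * 𝐮 ^ (k - 1)) = 0 := by
    rw [hη, ← pow_one 𝐡, Et_pow_mul_eq_zero one_ne_zero (E2_mul_ABG_pow hk'), map_zero]
  have h2 : ψ (zω * 𝐮 ^ (k - 1)) = 1 := by
    rw [hω, ← pow_one (𝐮 + 𝐯 + 𝐰), omega_pow_mul_ABG_pow hs one_ne_zero hk',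
      Nat.add_sub_cancel' hk.le, psi_ABG_pow_self (by omega) hs hψ]
  have h3 : ψ (zσ * 𝐮 ^ (k - 1)) = 0 := by
    rw [hσ, sigma_mul_ABG_pow (by omega) hs hk', map_zero]
  fin_cases j
  exacts [h1, h2, h3]

lemma psi_mul_Al (hk : 0 < k) (hs : 0 < s) (hψ : SoclePsi F k s c ψ)
    (hη : (zη : DA F k s c) = 𝐡) (hω : (zω : DA F k s c) = 𝐮 + 𝐯 + 𝐰)
    (hσ : (zσ : DA F k s c) = 𝐯 ^ (k - 1) * (𝐛 * 𝐠)) (j : Fin 3) :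
    ψ (![zη, zω, zσ] j * 𝐚) = if 2 = j then 1 else 0 := by
  have h1 : ψ (zη * 𝐚) = 0 := by
    rw [hη, ← pow_one 𝐡, Et_pow_mul_eq_zero one_ne_zero (E2_mul_Al F k s c), map_zero]
  have h2 : ψ (zω * 𝐚) = 0 := by
    rw [hω, ← pow_one (𝐮 + 𝐯 + 𝐰), omega_pow_mul_Al hs one_ne_zero, psi_ABG_pow_mul_Al hk hs hψ]
  have h3 : ψ (zσ * 𝐚) = 1 := by rw [hσ, sigma_mul_Al hk, psi_ABG_pow_self hk hs hψ]
  fin_cases j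
  exacts [h1, h2, h3]

/-- The generators `η`, `ω`, `σ` of the center quotient. -/
def zbarGen (ψ : DA F k s c →ₗ[F] F) (zη zω zσ : Subalgebra.center F (DA F k s c)) (j : Fin 3) :
    Zbar F k s c ψ :=
  zq F k s c ψ (![zη, zω, zσ] j)

lemma range_zbarGen : Set.range (zbarGen ψ zη zω zσ) =
    {zq F k s c ψ zη, zq F k s c ψ zω, zq F k s c ψ zσ} := by
  ext x
  simp [zbarGen, Fin.exists_fin_succ, eq_comm]

lemma range_zbarGen_castSucc : Set.range (fun j : Fin 2 => zbarGen ψ zη zω zσ j.castSucc) =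
    {zq F k s c ψ zη, zq F k s c ψ zω} := by
  ext x
  simp [zbarGen, Fin.exists_fin_succ, eq_comm]

lemma isNilpotent_zbarGen (hk : 1 < k) (hs : 0 < s) (hη : (zη : DA F k s c) = 𝐡)
    (hω : (zω : DA F k s c) = 𝐮 + 𝐯 + 𝐰) (hσ : (zσ : DA F k s c) = 𝐯 ^ (k - 1) * (𝐛 * 𝐠))
    (j : Fin 3) : IsNilpotent (zbarGen ψ zη zω zσ j) := by
  fin_cases j
  exacts [isNilpotent_zq_eta (by omega) hη, isNilpotent_zq_omega (by omega) hs hω,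
    isNilpotent_zq_sigma hk hσ]

lemma pairing_mul_zbarGen_mul_zbarGen {x : DA F k s c} (hx : x ∈ T1set F k s c) (j l : Fin 3)
    (h : ∀ z : Subalgebra.center F (DA F k s c), ψ (z * (((![zη, zω, zσ] j * ![zη, zω, zσ] l :
      Subalgebra.center F (DA F k s c)) : DA F k s c) * x)) = 0) (r : Zbar F k s c ψ) :
    pairing hx (r * (zbarGen ψ zη zω zσ j * zbarGen ψ zη zω zσ l)) = 0 := by
  obtain ⟨z, rfl⟩ := zq_surjective r
  rw [zbarGen, zbarGen, ← map_mul, ← map_mul, pairing_zq, Subalgebra.coe_mul, mul_assoc, h]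

lemma isDualFrame_of_eq_zero [CharP F 2] (hk : 2 < k) (hs : 2 < s) (hψ : SoclePsi F k s c ψ)
    (hc : c = 0) (hη : (zη : DA F k s c) = 𝐡) (hω : (zω : DA F k s c) = 𝐮 + 𝐯 + 𝐰)
    (hσ : (zσ : DA F k s c) = 𝐯 ^ (k - 1) * (𝐛 * 𝐠)) :
    IsDualFrame F (zbarGen ψ zη zω zσ)
      ![pairing (Et_pow_mem_T1set (by omega) hs), pairing (ABG_pow_mem_T1set hk),
        pairing (Al_mem_T1set hc)] where
  isNilpotent := isNilpotent_zbarGen (by omega) (by omega) hη hω hσ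
  sub_mem_span := by
    rw [range_zbarGen]
    exact exists_sub_mem_span_zq (by omega) (by omega) hψ hη hω hσ
  apply i j := by
    fin_cases i
    exacts [psi_mul_Et_pow (by omega) (by omega) hψ hη hω hσ j,
      psi_mul_ABG_pow (by omega) (by omega) hψ hη hω hσ j,
      psi_mul_Al (by omega) (by omega) hψ hη hω hσ j]
  apply_mul i j l r := by
    fin_cases i
    · refine pairing_mul_zbarGen_mul_zbarGen (Et_pow_mem_T1set (by omega) hs) j l (fun z => ?_) r
      rw [mul_mul_Et_pow (by omega) (by omega) hη hω hσ, mul_zero, map_zero]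
    · refine pairing_mul_zbarGen_mul_zbarGen (ABG_pow_mem_T1set hk) j l (fun z => ?_) r
      rw [mul_mul_ABG_pow (by omega) (by omega) hη hω hσ, mul_zero, map_zero]
    · exact pairing_mul_zbarGen_mul_zbarGen (Al_mem_T1set hc) j l
        (psi_mul_mul_Al (by omega) (by omega) hψ hη hω hσ j l) r

lemma zq_sigma_eq [CharP F 2] (hk : 0 < k) (hs : 0 < s) (hψ : SoclePsi F k s c ψ) (hc : c = 1)
    (hη : (zη : DA F k s c) = 𝐡) (hω : (zω : DA F k s c) = 𝐮 + 𝐯 + 𝐰)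
    (hσ : (zσ : DA F k s c) = 𝐯 ^ (k - 1) * (𝐛 * 𝐠)) {m n : ℕ} (hm : m + m = k)
    (hn : n + n = s) :
    zq F k s c ψ zσ = zq F k s c ψ zη ^ n + zq F k s c ψ zω ^ m := by
  rw [← map_pow, ← map_pow, ← map_add, zq_eq_iff]
  have ht := (zσ - (zη ^ n + zω ^ m)).2
  rw [Subalgebra.coe_sub, Subalgebra.coe_add, Subalgebra.coe_pow, Subalgebra.coe_pow, hη, hω,
    hσ] at ht
  rw [Subalgebra.coe_add, Subalgebra.coe_pow, Subalgebra.coe_pow, hη, hω, hσ]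
  exact sigma_sub_mem_T1perp hk hs hψ hc hm hn ht

lemma isDualFrame_of_eq_one [CharP F 2] (hk : 2 < k) (hkev : Even k) (hs : 2 < s) (hsev : Even s)
    (hψ : SoclePsi F k s c ψ) (hc : c = 1) (hη : (zη : DA F k s c) = 𝐡)
    (hω : (zω : DA F k s c) = 𝐮 + 𝐯 + 𝐰) (hσ : (zσ : DA F k s c) = 𝐯 ^ (k - 1) * (𝐛 * 𝐠)) :
    IsDualFrame F (fun j : Fin 2 => zbarGen ψ zη zω zσ j.castSucc)
      ![pairing (Et_pow_mem_T1set (by omega) hs), pairing (ABG_pow_mem_T1set hk)] where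
  isNilpotent j := isNilpotent_zbarGen (by omega) (by omega) hη hω hσ _
  sub_mem_span x := by
    obtain ⟨a, ha⟩ := exists_sub_mem_span_zq (by omega) (by omega) hψ hη hω hσ x
    refine ⟨a, ?_⟩
    rw [range_zbarGen_castSucc]
    refine (Ideal.span_le.mpr ?_) ha
    obtain ⟨m, hm⟩ := hkev
    obtain ⟨n, hn⟩ := hsev
    have h1 : zq F k s c ψ zη ∈ Ideal.span {zq F k s c ψ zη, zq F k s c ψ zω} :=
      Ideal.subset_span (by simp)
    have h2 : zq F k s c ψ zω ∈ Ideal.span {zq F k s c ψ zη, zq F k s c ψ zω} :=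
      Ideal.subset_span (by simp)
    rintro y (rfl | rfl | rfl)
    · exact h1
    · exact h2
    · rw [zq_sigma_eq (by omega) (by omega) hψ hc hη hω hσ hm.symm hn.symm]
      exact add_mem (Ideal.pow_mem_of_mem _ h1 _ (by omega))
        (Ideal.pow_mem_of_mem _ h2 _ (by omega))
  apply i j := by
    fin_cases i
    · refine (psi_mul_Et_pow (by omega) (by omega) hψ hη hω hσ j.castSucc).trans ?_
      fin_cases j <;> rfl
    · refine (psi_mul_ABG_pow (by omega) (by omega) hψ hη hω hσ j.castSucc).trans ?_
      fin_cases j <;> rfl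
  apply_mul i j l r := by
    fin_cases i
    · refine pairing_mul_zbarGen_mul_zbarGen (Et_pow_mem_T1set (by omega) hs) j.castSucc l.castSucc
        (fun z => ?_) r
      rw [mul_mul_Et_pow (by omega) (by omega) hη hω hσ, mul_zero, map_zero]
    · refine pairing_mul_zbarGen_mul_zbarGen (ABG_pow_mem_T1set hk) j.castSucc l.castSucc
        (fun z => ?_) r
      rw [mul_mul_ABG_pow (by omega) (by omega) hη hω hσ, mul_zero, map_zero]

end Frames

end Paths

/-- **Case `k > 2`, `s > 2` both even (dihedral type).**  With
`Z̄_c = Z(A^{k,s}_c)/T₁^⊥` and `J̄_c = rad(Z̄_c)`: in `Z̄₁` the relation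
`(βγα)^{k-1}βγ = η^{s/2} + (αβγ)^{k/2} + (βγα)^{k/2} + (γαβ)^{k/2}` holds,
`J̄₁/J̄₁²` has dimension 2 (spanned by the cosets of `η` and `αβγ + βγα + γαβ`), and
`J̄₀/J̄₀²` has dimension 3 (spanned by the cosets of `η`, `αβγ + βγα + γαβ` and
`(βγα)^{k-1}βγ`).  In particular `Z̄₀ ≇ Z̄₁` as F-algebras. -/
theorem dihedral_radical_quotients_even_even
    (F : Type) [Field F] [IsAlgClosed F] [CharP F 2]
    (k s : ℕ) (hk : 2 < k) (hkev : Even k) (hs : 2 < s) (hsev : Even s)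
    (ψ0 : DA F k s 0 →ₗ[F] F) (hψ0 : SoclePsi F k s 0 ψ0)
    (ψ1 : DA F k s 1 →ₗ[F] F) (hψ1 : SoclePsi F k s 1 ψ1)
    (zη0 zω0 zσ0 : Subalgebra.center F (DA F k s 0))
    (hzη0 : (zη0 : DA F k s 0) = Et F k s 0)
    (hzω0 : (zω0 : DA F k s 0) = ABG F k s 0 + BGA F k s 0 + GAB F k s 0)
    (hzσ0 : (zσ0 : DA F k s 0)
      = (BGA F k s 0) ^ (k - 1) * (Be F k s 0 * Ga F k s 0))
    (zη1 zω1 zσ1 zh1 zk1 : Subalgebra.center F (DA F k s 1))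
    (hzη1 : (zη1 : DA F k s 1) = Et F k s 1)
    (hzω1 : (zω1 : DA F k s 1) = ABG F k s 1 + BGA F k s 1 + GAB F k s 1)
    (hzσ1 : (zσ1 : DA F k s 1)
      = (BGA F k s 1) ^ (k - 1) * (Be F k s 1 * Ga F k s 1))
    (hzh1 : (zh1 : DA F k s 1) = (Et F k s 1) ^ (s / 2))
    (hzk1 : (zk1 : DA F k s 1)
      = (ABG F k s 1) ^ (k / 2) + (BGA F k s 1) ^ (k / 2) + (GAB F k s 1) ^ (k / 2)) :
    zq F k s 1 ψ1 zσ1 = zq F k s 1 ψ1 zh1 + zq F k s 1 ψ1 zk1 ∧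
    (Submodule.restrictScalars F (Jbar F k s 1 ψ1)
      = Submodule.span F {zq F k s 1 ψ1 zη1, zq F k s 1 ψ1 zω1}
          ⊔ Submodule.restrictScalars F (Jbar F k s 1 ψ1 * Jbar F k s 1 ψ1)) ∧
    radQuotDim F (Jbar F k s 1 ψ1) = 2 ∧
    (Submodule.restrictScalars F (Jbar F k s 0 ψ0)
      = Submodule.span F {zq F k s 0 ψ0 zη0, zq F k s 0 ψ0 zω0, zq F k s 0 ψ0 zσ0}
          ⊔ Submodule.restrictScalars F (Jbar F k s 0 ψ0 * Jbar F k s 0 ψ0)) ∧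
    radQuotDim F (Jbar F k s 0 ψ0) = 3 ∧
    IsEmpty (Zbar F k s 0 ψ0 ≃ₐ[F] Zbar F k s 1 ψ1) := by
  have h0 := isDualFrame_of_eq_zero hk hs hψ0 rfl hzη0 hzω0 hzσ0
  have h1 := isDualFrame_of_eq_one hk hkev hs hsev hψ1 rfl hzη1 hzω1 hzσ1
  obtain ⟨m, rfl⟩ := hkev
  obtain ⟨n, rfl⟩ := hsev
  have hh : zh1 = zη1 ^ n := Subtype.ext (by
    rw [hzh1, Subalgebra.coe_pow, hzη1, show (n + n) / 2 = n by omega])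
  have hk1 : zk1 = zω1 ^ m := Subtype.ext (by
    rw [hzk1, Subalgebra.coe_pow, hzω1, omega_pow (by omega) (by omega),
      show (m + m) / 2 = m by omega])
  have hdim := h0.radQuotDim_eq_card
  refine ⟨?_, ?_, h1.radQuotDim_eq_card, ?_, hdim, ⟨fun e => ?_⟩⟩
  · rw [hh, hk1, map_pow, map_pow]
    exact zq_sigma_eq (by omega) (by omega) hψ1 rfl hzη1 hzω1 hzσ1 rfl rfl
  · rw [← range_zbarGen_castSucc (zσ := zσ1)]
    exact h1.restrictScalars_jacobson_bot
  · rw [← range_zbarGen]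
    exact h0.restrictScalars_jacobson_bot
  · rw [(h1.comp_equiv e).radQuotDim_eq_card] at hdim
    simp at hdim

end DihedralPaper

end
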